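/- The problem of deciding, given a non-deterministic Turing machine M and a state q_r of M, whether M is robust non-recurring through q_r (i.e., every run of M starting from any configuration features q_r only finitely many times) is Π¹₁-complete. -/

import Mathlib

/-!
Common formalization framework for "Restricted Chase Termination: You Want More than Fairness"
(Carral, Gerlach, Larroque, Thomazo).

Syntax is encoded over natural numbers so that all finite objects (rules, databases, knowledge
bases, Turing machines) live in `Primcodable` types, which allows us to speak about
many-one reductions and about the arithmetical/analytical hierarchy.
-/

namespace ChaseTermination

/-! ### Terms, atoms, facts, rules, knowledge bases -/

/-- Ground terms: `Sum.inl c` is the constant `c`, `Sum.inr n` is the null `n`. -/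
abbrev GroundTerm : Type := ℕ ⊕ ℕ

/-- Terms of rules: `Sum.inl v` is the variable `v`, `Sum.inr g` a ground term. -/
abbrev RTerm : Type := ℕ ⊕ GroundTerm

/-- A fact: a predicate (coded by a natural number) applied to ground terms. -/
abbrev Fact : Type := ℕ × List GroundTerm

/-- An atom: a predicate applied to terms. -/
abbrev Atom : Type := ℕ × List RTerm

/-- An existential rule, given by its body and its head (lists of atoms);
the universally quantified variables are those occurring in the body, the existentially
quantified ones are the head variables not occurring in the body. -/
abbrev Rule : Type := List Atom × List Atom

abbrev RuleSet : Type := List Rule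

abbrev Database : Type := List Fact

/-- A knowledge base: a (finite) rule set together with a database. -/
abbrev KB : Type := RuleSet × Database

def atomHasVar (a : Atom) (v : ℕ) : Prop := (Sum.inl v : RTerm) ∈ a.2

def atomNullFree (a : Atom) : Prop := ∀ t ∈ a.2, ∀ n : ℕ, t ≠ Sum.inr (Sum.inr n)

def factNullFree (f : Fact) : Prop := ∀ t ∈ f.2, ∀ n : ℕ, t ≠ Sum.inr n

/-- A database is a finite fact set without nulls. -/
def IsDatabase (D : Database) : Prop := ∀ f ∈ D, factNullFree f

/-- Well-formed rule: non-empty head, no nulls. -/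
def IsRule (r : Rule) : Prop := r.2 ≠ [] ∧ ∀ a ∈ r.1 ++ r.2, atomNullFree a

def IsRuleSet (S : RuleSet) : Prop := ∀ r ∈ S, IsRule r

def IsKB (kb : KB) : Prop := IsRuleSet kb.1 ∧ IsDatabase kb.2

/-- `v` occurs in the body of `r` (i.e. is universally quantified). -/
def bodyVar (r : Rule) (v : ℕ) : Prop := ∃ a ∈ r.1, atomHasVar a v

/-- `v` is an existential variable of `r`. -/
def existVar (r : Rule) (v : ℕ) : Prop := (∃ a ∈ r.2, atomHasVar a v) ∧ ¬ bodyVar r v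

def applyT (σ : ℕ → GroundTerm) : RTerm → GroundTerm
  | Sum.inl v => σ v
  | Sum.inr g => g

def applyA (σ : ℕ → GroundTerm) (a : Atom) : Fact := (a.1, a.2.map (applyT σ))

/-- A trigger: a rule together with a substitution for its (universal) variables. -/
abbrev Trigger : Type := Rule × (ℕ → GroundTerm)

/-- The support of a trigger: the instantiated body. -/
def support (t : Trigger) : Set Fact := {f | ∃ a ∈ t.1.1, f = applyA t.2 a}

/-- A trigger is loaded for `F` if `F` includes its support. -/
def loaded (t : Trigger) (F : Set Fact) : Prop := ∀ a ∈ t.1.1, applyA t.2 a ∈ F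

/-- `σ'` agrees with the substitution of `t` on all universally quantified (body) variables. -/
def agreesOnBody (t : Trigger) (σ' : ℕ → GroundTerm) : Prop :=
  ∀ v, bodyVar t.1 v → σ' v = t.2 v

/-- A trigger is obsolete for `F` if some extension of its substitution to the existential
variables sends the head into `F`. -/
def obsolete (t : Trigger) (F : Set Fact) : Prop :=
  ∃ σ' : ℕ → GroundTerm, agreesOnBody t σ' ∧ ∀ a ∈ t.1.2, applyA σ' a ∈ F

/-- The (ground) terms occurring in a fact set. -/
def termsOf (F : Set Fact) : Set GroundTerm := {g | ∃ f ∈ F, g ∈ f.2}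

/-- `σ'` is a proper output extension of the trigger `t` w.r.t. `F`: it agrees with the trigger
substitution on body variables and maps existential variables to pairwise distinct fresh nulls. -/
def properExt (t : Trigger) (F : Set Fact) (σ' : ℕ → GroundTerm) : Prop :=
  agreesOnBody t σ' ∧
  (∀ v, existVar t.1 v → ∃ n : ℕ, σ' v = Sum.inr n ∧ (Sum.inr n : GroundTerm) ∉ termsOf F) ∧
  (∀ v w, existVar t.1 v → existVar t.1 w → σ' v = σ' w → v = w)

/-- The output of a trigger under an extended substitution. -/
def outputOf (t : Trigger) (σ' : ℕ → GroundTerm) : Set Fact := {f | ∃ a ∈ t.1.2, f = applyA σ' a}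

/-- An active trigger of `S` for `F`: loaded and not obsolete. -/
def Active (S : RuleSet) (F : Set Fact) (t : Trigger) : Prop :=
  t.1 ∈ S ∧ loaded t F ∧ ¬ obsolete t F

/-- One restricted chase step. -/
def ChaseStep (S : RuleSet) (F F' : Set Fact) : Prop :=
  ∃ t : Trigger, Active S F t ∧ ∃ σ', properExt t F σ' ∧ F' = F ∪ outputOf t σ'

def dbSet (D : Database) : Set Fact := {f | f ∈ D}

/-- A (possibly infinite) restricted chase derivation for `⟨S, D⟩`, of length `len ∈ ℕ∞`.
Beyond the length the fact sets stall, so that the result is always `⋃ i, fact i`. -/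
structure Chase (S : RuleSet) (D : Set Fact) where
  len : ℕ∞
  fact : ℕ → Set Fact
  trig : ℕ → Trigger
  ext : ℕ → ℕ → GroundTerm
  init : fact 0 = D
  activeAt : ∀ i : ℕ, (i : ℕ∞) < len → Active S (fact i) (trig i)
  extOk : ∀ i : ℕ, (i : ℕ∞) < len → properExt (trig i) (fact i) (ext i)
  succ : ∀ i : ℕ, (i : ℕ∞) < len → fact (i + 1) = fact i ∪ outputOf (trig i) (ext i)
  stall : ∀ i : ℕ, ¬ ((i : ℕ∞) < len) → fact (i + 1) = fact i

/-- Fairness: every trigger that becomes loaded is eventually obsolete.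
A fair chase derivation is a *restricted chase sequence*; note that for a finite derivation
fairness forces maximality (no active trigger remains at the end). -/
def Fair {S : RuleSet} {D : Set Fact} (c : Chase S D) : Prop :=
  ∀ t : Trigger, t.1 ∈ S → ∀ i : ℕ, loaded t (c.fact i) → ∃ j : ℕ, i ≤ j ∧ obsolete t (c.fact j)

/-- The result of a chase derivation. -/
def chaseResult {S : RuleSet} {D : Set Fact} (c : Chase S D) : Set Fact := ⋃ i, c.fact i

/-- The derivation is infinite (non-terminating). -/
def IsInfinite {S : RuleSet} {D : Set Fact} (c : Chase S D) : Prop := c.len = ⊤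

/-- `TKR∀`: knowledge bases all of whose restricted chase sequences are finite. -/
def TKRall (kb : KB) : Prop :=
  IsKB kb ∧ ¬ ∃ c : Chase kb.1 (dbSet kb.2), IsInfinite c ∧ Fair c

/-- `TRR∀`: rule sets universally terminating for the restricted chase on every database. -/
def TRRall (S : RuleSet) : Prop :=
  IsRuleSet S ∧ ∀ D : Database, IsDatabase D → ¬ ∃ c : Chase S (dbSet D), IsInfinite c ∧ Fair c

/-! ### Breadth-first chase -/

/-- The instance of a trigger: its rule together with its instantiated body (this determines the
substitution on all body variables). -/
def instOf (t : Trigger) : Rule × List Fact := (t.1, t.1.1.map (applyA t.2))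

/-- The set of instances of active triggers (this is what "the number of triggers that are loaded
and not obsolete" counts). -/
def activeInsts (S : RuleSet) (F : Set Fact) : Set (Rule × List Fact) :=
  {p | ∃ t : Trigger, Active S F t ∧ p = instOf t}

/-- The breadth-first condition (†): a trigger loaded at step `i` becomes obsolete within the
next `n` steps, where `n` is the number of active triggers at step `i`. -/
def BreadthFirst {S : RuleSet} {D : Set Fact} (c : Chase S D) : Prop :=
  ∀ i : ℕ, ∀ t : Trigger, t.1 ∈ S → loaded t (c.fact i) →
    ∃ j : ℕ, i ≤ j ∧ j ≤ i + (activeInsts S (c.fact i)).ncard ∧ obsolete t (c.fact j)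

/-- `TKRBF∀`: knowledge bases all of whose breadth-first chase sequences are finite. -/
def TKRBFall (kb : KB) : Prop :=
  IsKB kb ∧ ¬ ∃ c : Chase kb.1 (dbSet kb.2), IsInfinite c ∧ BreadthFirst c

/-- `TRRBF∀`: rule sets whose breadth-first chase terminates on every database. -/
def TRRBFall (S : RuleSet) : Prop :=
  IsRuleSet S ∧ ∀ D : Database, IsDatabase D →
    ¬ ∃ c : Chase S (dbSet D), IsInfinite c ∧ BreadthFirst c

/-! ### Classes of the arithmetical and analytical hierarchies -/

/-- `Π⁰₂` predicates, via the Kleene normal form `∀ m ∃ k. R`. -/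
def Pi02 {α : Type} [Primcodable α] (p : α → Prop) : Prop :=
  ∃ R : α × ℕ → ℕ → Bool, Computable₂ R ∧ ∀ a, p a ↔ ∀ m : ℕ, ∃ k : ℕ, R (a, m) k = true

/-- `Π¹₁` predicates, via the Kleene normal form: `p a` iff for every function `f : ℕ → ℕ` some
finite initial segment of `f` witnesses a computable predicate. -/
def Pi11 {α : Type} [Primcodable α] (p : α → Prop) : Prop :=
  ∃ R : α → List ℕ → Bool, Computable₂ R ∧
    ∀ a, p a ↔ ∀ f : ℕ → ℕ, ∃ k : ℕ, R a ((List.range k).map f) = true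

/-- `Π¹₁`-hardness: every `Π¹₁` problem many-one reduces to `p`. -/
def Pi11Hard {α : Type} [Primcodable α] (p : α → Prop) : Prop :=
  ∀ q : ℕ → Prop, Pi11 q → q ≤₀ p

def Pi11Complete {α : Type} [Primcodable α] (p : α → Prop) : Prop := Pi11 p ∧ Pi11Hard p

/-! ### Non-deterministic Turing machines -/

/-- A non-deterministic Turing machine `(numStates, alphaSize, table)`.
States are `0, …, numStates - 1` with initial state `0`; tape symbols `0, …, alphaSize - 1`
form `Γ` (so `{0,1} ⊆ Γ` iff `2 ≤ alphaSize`), and the blank `B` is coded by `alphaSize`.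
An entry `((q, a), (q', b, d))` means `(q', b, d) ∈ δ(q, a)`, with `d = true` for a right move
and `d = false` for a left move. -/
abbrev NTM : Type := ℕ × ℕ × List ((ℕ × ℕ) × (ℕ × ℕ × Bool))

def NTM.numStates (M : NTM) : ℕ := M.1
def NTM.blank (M : NTM) : ℕ := M.2.1
def NTM.table (M : NTM) : List ((ℕ × ℕ) × (ℕ × ℕ × Bool)) := M.2.2

/-- Well-formedness: `Γ ⊇ {0,1}`, transitions use valid states and symbols, and the machine
never writes the blank. -/
def NTM.WF (M : NTM) : Prop :=
  1 ≤ NTM.numStates M ∧ 2 ≤ NTM.blank M ∧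
    ∀ e ∈ NTM.table M, e.1.1 < NTM.numStates M ∧ e.1.2 ≤ NTM.blank M ∧
      e.2.1 < NTM.numStates M ∧ e.2.2.1 < NTM.blank M

/-- A configuration `(tape, p, q)`: tape contents (a list of symbol codes whose last cell is
blank and in which no proper symbol occurs after a blank), 0-based head position `p`,
and current state `q`. -/
abbrev Config : Type := List ℕ × ℕ × ℕ

def WFConfig (M : NTM) (ρ : Config) : Prop :=
  ρ.2.1 < ρ.1.length ∧ ρ.1.getLast? = some (NTM.blank M) ∧
    (∀ i j : ℕ, i ≤ j → j < ρ.1.length → ρ.1.getD i 0 = NTM.blank M →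
      ρ.1.getD j 0 = NTM.blank M) ∧
    (∀ a ∈ ρ.1, a ≤ NTM.blank M) ∧ ρ.2.2 < NTM.numStates M

/-- The one-step relation `Next_M` between configurations; each step extends the represented
part of the tape by one blank cell. -/
def NTM.Next (M : NTM) (ρ ρ' : Config) : Prop :=
  ∃ q' b : ℕ, ∃ d : Bool,
    ((ρ.2.2, ρ.1.getD ρ.2.1 0), (q', b, d)) ∈ NTM.table M ∧
    (d = true ∨ 1 ≤ ρ.2.1) ∧
    ρ' = (ρ.1.set ρ.2.1 b ++ [NTM.blank M], if d then ρ.2.1 + 1 else ρ.2.1 - 1, q')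

/-- The starting configuration of `M` on a word. -/
def startConfig (M : NTM) (w : List ℕ) : Config := (w ++ [NTM.blank M], 0, 0)

/-- Words are over the input alphabet `{0, 1}`. -/
def IsWord (w : List ℕ) : Prop := ∀ a ∈ w, a < 2

/-- There is a run of `M` starting in `ρ` that visits the state `qr` infinitely often.
(Such a run is necessarily infinite, and every infinite sequence of `Next_M`-successive
configurations is a run; finite runs trivially feature `qr` only finitely many times.) -/
def RecurringFrom (M : NTM) (qr : ℕ) (ρ : Config) : Prop :=
  ∃ c : ℕ → Config, c 0 = ρ ∧ (∀ i, NTM.Next M (c i) (c (i + 1))) ∧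
    ∀ N : ℕ, ∃ i : ℕ, N ≤ i ∧ (c i).2.2 = qr

/-- `M` is non-recurring through `qr` on the configuration `ρ`: every run of `M` on `ρ`
features `qr` only finitely many times. -/
def NonRecurringFrom (M : NTM) (qr : ℕ) (ρ : Config) : Prop := ¬ RecurringFrom M qr ρ

end ChaseTermination
namespace ChaseTermination

/-! ### The rule set `Σ_M` of Section 4 and the databases `D_ρ` -/

/-- Predicate codes. `pF`, `pR` are the ternary time/tape successor predicates. -/
def pF : ℕ := 0
def pR : ℕ := 1
def pCL : ℕ := 2
def pCR : ℕ := 3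
def pReal : ℕ := 4
def pBrake : ℕ := 5
def pNextBr : ℕ := 6
def pEnd : ℕ := 7
/-- The binary letter predicate for the tape symbol `a`. -/
def pLetter (a : ℕ) : ℕ := 8 + 2 * a
/-- The binary state predicate for the state `q`. -/
def pState (q : ℕ) : ℕ := 9 + 2 * q

/-- Variable codes used in the rules: `x, y, x', y', w, w'` are `0, …, 5`. -/
def tv (v : ℕ) : RTerm := Sum.inl v

def A1 (p : ℕ) (s : RTerm) : Atom := (p, [s])
def A2 (p : ℕ) (s t : RTerm) : Atom := (p, [s, t])
def A3 (p : ℕ) (s t u : RTerm) : Atom := (p, [s, t, u])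

/-- `brSet(x, w)` as atoms: `{F(x,w,w), R(x,w,w), Real(x), Brake(w)}`. -/
def brSetA (x w : RTerm) : List Atom := [A3 pF x w w, A3 pR x w w, A1 pReal x, A1 pBrake w]

/-- Tape alphabet including the blank: `Γ ∪ {B}`. -/
def letters (M : NTM) : List ℕ := List.range (NTM.blank M + 1)
def states (M : NTM) : List ℕ := List.range (NTM.numStates M)

/-- The rule `R_Brake`. -/
def ruleBrake (M : NTM) : Rule :=
  ([A1 pBrake (tv 4)],
    ((letters M).map fun a => A2 (pLetter a) (tv 4) (tv 4)) ++
    ((states M).map fun q => A2 (pState q) (tv 4) (tv 4)) ++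
    [A3 pF (tv 4) (tv 4) (tv 4), A3 pR (tv 4) (tv 4) (tv 4),
     A2 pCL (tv 4) (tv 4), A2 pCR (tv 4) (tv 4), A1 pReal (tv 4), A2 pNextBr (tv 4) (tv 4)])

/-- The rule `R_nextBr`. -/
def ruleNextBr : Rule :=
  (brSetA (tv 0) (tv 4) ++ [A2 pNextBr (tv 4) (tv 5)], brSetA (tv 0) (tv 5))

/-- Transition rule for `(q', b, →) ∈ δ(q, a)` and the letter `c`; if `q = qr` a fresh
brake `w'` is created together with a `nextBr`-atom, otherwise the brake `w` is reused. -/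
def mkTransRight (qr q a q' b c : ℕ) : Rule :=
  ([A2 (pState q) (tv 0) (tv 4), A2 (pLetter a) (tv 0) (tv 4), A3 pR (tv 0) (tv 1) (tv 4),
    A2 (pLetter c) (tv 1) (tv 4)] ++ brSetA (tv 0) (tv 4) ++ brSetA (tv 1) (tv 4),
   if q = qr then
     [A2 (pState q') (tv 3) (tv 5), A2 (pLetter c) (tv 3) (tv 5), A2 (pLetter b) (tv 2) (tv 5),
      A3 pR (tv 2) (tv 3) (tv 5), A3 pF (tv 0) (tv 2) (tv 5), A3 pF (tv 1) (tv 3) (tv 5),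
      A2 pCL (tv 2) (tv 5), A2 pCR (tv 3) (tv 5)] ++
      brSetA (tv 2) (tv 5) ++ brSetA (tv 3) (tv 5) ++ [A2 pNextBr (tv 4) (tv 5)]
   else
     [A2 (pState q') (tv 3) (tv 4), A2 (pLetter c) (tv 3) (tv 4), A2 (pLetter b) (tv 2) (tv 4),
      A3 pR (tv 2) (tv 3) (tv 4), A3 pF (tv 0) (tv 2) (tv 4), A3 pF (tv 1) (tv 3) (tv 4),
      A2 pCL (tv 2) (tv 4), A2 pCR (tv 3) (tv 4)] ++ brSetA (tv 2) (tv 4) ++ brSetA (tv 3) (tv 4))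

/-- Transition rule for `(q', b, ←) ∈ δ(q, a)` and the letter `c`. -/
def mkTransLeft (qr q a q' b c : ℕ) : Rule :=
  ([A2 (pState q) (tv 0) (tv 4), A2 (pLetter a) (tv 0) (tv 4), A3 pR (tv 1) (tv 0) (tv 4),
    A2 (pLetter c) (tv 1) (tv 4)] ++ brSetA (tv 0) (tv 4) ++ brSetA (tv 1) (tv 4),
   if q = qr then
     [A2 (pState q') (tv 3) (tv 5), A2 (pLetter c) (tv 3) (tv 5), A2 (pLetter b) (tv 2) (tv 5),
      A3 pR (tv 3) (tv 2) (tv 5), A3 pF (tv 0) (tv 2) (tv 5), A3 pF (tv 1) (tv 3) (tv 5),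
      A2 pCL (tv 3) (tv 5), A2 pCR (tv 2) (tv 5)] ++
      brSetA (tv 2) (tv 5) ++ brSetA (tv 3) (tv 5) ++ [A2 pNextBr (tv 4) (tv 5)]
   else
     [A2 (pState q') (tv 3) (tv 4), A2 (pLetter c) (tv 3) (tv 4), A2 (pLetter b) (tv 2) (tv 4),
      A3 pR (tv 3) (tv 2) (tv 4), A3 pF (tv 0) (tv 2) (tv 4), A3 pF (tv 1) (tv 3) (tv 4),
      A2 pCL (tv 3) (tv 4), A2 pCR (tv 2) (tv 4)] ++ brSetA (tv 2) (tv 4) ++ brSetA (tv 3) (tv 4))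

/-- All transition rules of `Σ_M` (one per table entry and letter `c`). -/
def transRules (M : NTM) (qr : ℕ) : List Rule :=
  (NTM.table M).foldr (fun e acc =>
    ((letters M).map fun cc =>
      if e.2.2.2 = true then mkTransRight qr e.1.1 e.1.2 e.2.1 e.2.2.1 cc
      else mkTransLeft qr e.1.1 e.1.2 e.2.1 e.2.2.1 cc) ++ acc) []

/-- The rule `R_{C_R}` for the letter `a`. -/
def mkCopyRight (a : ℕ) : Rule :=
  ([A2 pCR (tv 2) (tv 5), A3 pF (tv 0) (tv 2) (tv 5), A3 pR (tv 0) (tv 1) (tv 4),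
    A2 (pLetter a) (tv 1) (tv 4)] ++
    brSetA (tv 0) (tv 4) ++ brSetA (tv 2) (tv 5) ++ brSetA (tv 1) (tv 4),
   [A3 pF (tv 1) (tv 3) (tv 5), A3 pR (tv 2) (tv 3) (tv 5), A2 (pLetter a) (tv 3) (tv 5),
    A2 pCR (tv 3) (tv 5)] ++ brSetA (tv 3) (tv 5))

/-- The rule `R_{C_L}` for the letter `a`. -/
def mkCopyLeft (a : ℕ) : Rule :=
  ([A2 pCL (tv 2) (tv 5), A3 pF (tv 0) (tv 2) (tv 5), A3 pR (tv 1) (tv 0) (tv 4),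
    A2 (pLetter a) (tv 1) (tv 4)] ++
    brSetA (tv 0) (tv 4) ++ brSetA (tv 2) (tv 5) ++ brSetA (tv 1) (tv 4),
   [A3 pF (tv 1) (tv 3) (tv 5), A3 pR (tv 3) (tv 2) (tv 5), A2 (pLetter a) (tv 3) (tv 5),
    A2 pCL (tv 3) (tv 5)] ++ brSetA (tv 3) (tv 5))

def copyRightRules (M : NTM) : List Rule := (letters M).map mkCopyRight
def copyLeftRules (M : NTM) : List Rule := (letters M).map mkCopyLeft

/-- The tape-extension rule `R_End`. -/
def ruleEnd (M : NTM) : Rule :=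
  ([A2 pCR (tv 2) (tv 5), A3 pF (tv 0) (tv 2) (tv 5), A2 pEnd (tv 0) (tv 4)] ++
    brSetA (tv 0) (tv 4) ++ brSetA (tv 2) (tv 5),
   [A3 pR (tv 2) (tv 3) (tv 5), A2 (pLetter (NTM.blank M)) (tv 3) (tv 5),
    A2 pEnd (tv 3) (tv 5)] ++ brSetA (tv 3) (tv 5))

/-- The rule set `Σ_M` of Section 4 (simulating `M`, with the designated state `qr`). -/
def SigmaM (M : NTM) (qr : ℕ) : RuleSet :=
  [ruleBrake M, ruleNextBr] ++ transRules M qr ++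
    copyLeftRules M ++ copyRightRules M ++ [ruleEnd M]

/-- The constant `c_i` (0-based). -/
def cst (i : ℕ) : GroundTerm := Sum.inl (i + 1)
/-- The brake constant `w₁` of the database. -/
def w1 : GroundTerm := Sum.inl 0

/-- `brSet(x, w)` as facts. -/
def brSetF (x w : GroundTerm) : List Fact :=
  [(pF, [x, w, w]), (pR, [x, w, w]), (pReal, [x]), (pBrake, [w])]

/-- The database `D_ρ` encoding a configuration `ρ`. -/
def Drho (M : NTM) (ρ : Config) : Database :=
  ((List.range ρ.1.length).map fun i => ((pR, [cst i, cst (i + 1), w1]) : Fact)) ++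
  ((List.range ρ.1.length).map fun i => ((pLetter (ρ.1.getD i 0), [cst i, w1]) : Fact)) ++
  [((pState ρ.2.2, [cst ρ.2.1, w1]) : Fact),
   ((pLetter (NTM.blank M), [cst ρ.1.length, w1]) : Fact),
   ((pEnd, [cst ρ.1.length, w1]) : Fact)] ++
  (List.range (ρ.1.length + 1)).foldr (fun i acc => brSetF (cst i) w1 ++ acc) []

/-! ### Wild frontiers -/

/-- The atoms explicitly required by the wild-frontier condition ("other" atoms are those
not in this set). -/
def wfListed (M : NTM) (ρ : Config) (w : GroundTerm) (x : ℕ → GroundTerm) : Set Fact :=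
  {f | (∃ i < ρ.1.length,
          f = ((pR, [x i, x (i + 1), w]) : Fact) ∨
          f = ((pLetter (ρ.1.getD i 0), [x i, w]) : Fact)) ∨
    f = ((pState ρ.2.2, [x ρ.2.1, w]) : Fact) ∨
    f = ((pEnd, [x ρ.1.length, w]) : Fact) ∨
    f = ((pLetter (NTM.blank M), [x ρ.1.length, w]) : Fact) ∨
    (∃ i ≤ ρ.1.length, f ∈ brSetF (x i) w)}

/-- `F` has a wild frontier of the configuration `ρ` overseen by `w` (Definition 4.4). -/
def WildFrontier (M : NTM) (F : Set Fact) (ρ : Config) (w : GroundTerm) : Prop :=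
  ∃ x : ℕ → GroundTerm,
    ((pReal, [w]) : Fact) ∉ F ∧
    (∀ i < ρ.1.length, ((pR, [x i, x (i + 1), w]) : Fact) ∈ F ∧
      ((pLetter (ρ.1.getD i 0), [x i, w]) : Fact) ∈ F) ∧
    ((pState ρ.2.2, [x ρ.2.1, w]) : Fact) ∈ F ∧
    ((pEnd, [x ρ.1.length, w]) : Fact) ∈ F ∧
    ((pLetter (NTM.blank M), [x ρ.1.length, w]) : Fact) ∈ F ∧
    (∀ i ≤ ρ.1.length, ∀ f ∈ brSetF (x i) w, f ∈ F) ∧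
    (∀ f ∈ F, f ∉ wfListed M ρ w x →
      ∀ i ≤ ρ.1.length, f.2.head? = some (x i) → f.2[1]? = some w)

/-! ### State atoms, generation, bow ties -/

/-- `g` is a brake of `F`. -/
def isBrake (F : Set Fact) (g : GroundTerm) : Prop := ((pBrake, [g]) : Fact) ∈ F

/-- A state atom of `F`: an atom `q(x, w)` with `q` a state of `M` and `x` not a brake. -/
def StateAtom (M : NTM) (F : Set Fact) (f : Fact) : Prop :=
  ∃ q : ℕ, q < NTM.numStates M ∧ ∃ x wb : GroundTerm,
    f = ((pState q, [x, wb]) : Fact) ∧ f ∈ F ∧ ¬ isBrake F x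

/-- `A` precedes `A'` in the derivation `c`: some applied trigger has `A` in its support
and `A'` in its output. -/
def precedes {S : RuleSet} {D : Set Fact} (c : Chase S D) (A A' : Fact) : Prop :=
  ∃ i : ℕ, (i : ℕ∞) < c.len ∧ A ∈ support (c.trig i) ∧ A' ∈ outputOf (c.trig i) (c.ext i)

/-- The fact `f` is generated (newly produced) at step `i` of the derivation `c`. -/
def generatedAt {S : RuleSet} {D : Set Fact} (c : Chase S D) (i : ℕ) (f : Fact) : Prop :=
  (i : ℕ∞) < c.len ∧ f ∈ outputOf (c.trig i) (c.ext i) ∧ f ∉ c.fact i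

/-- The fact `f` is generated by (an application of) one of the rules in `Rs`. -/
def generatedBy {S : RuleSet} {D : Set Fact} (c : Chase S D) (Rs : List Rule) (f : Fact) : Prop :=
  ∃ i : ℕ, generatedAt c i f ∧ (c.trig i).1 ∈ Rs

/-- Semantically meaningful terms: all terms of `F` except the brakes. -/
def semterms (F : Set Fact) : Set GroundTerm := {g | g ∈ termsOf F ∧ ¬ isBrake F g}

/-- The edge relation `E_R`: `(x, y) ∈ E_R` iff `R(x, y, w) ∈ F` for some `w`. -/
def ER (F : Set Fact) (u v : GroundTerm) : Prop := ∃ w, ((pR, [u, v, w]) : Fact) ∈ F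

/-- The weakly connected component of `x` in the graph induced by `E` on the vertex set `V`. -/
def wcc {α : Type} (V : Set α) (E : α → α → Prop) (x : α) : Set α :=
  {z | z ∈ V ∧ Relation.ReflTransGen (fun u v => u ∈ V ∧ v ∈ V ∧ (E u v ∨ E v u)) x z}

/-- Directed tree rooted in `r` on the vertex set `V` with edge relation `E`. -/
def IsDirTree {α : Type} (V : Set α) (E : α → α → Prop) (r : α) : Prop :=
  r ∈ V ∧
  (∀ v ∈ V, Relation.ReflTransGen (fun u v' => u ∈ V ∧ v' ∈ V ∧ E u v') r v) ∧
  (∀ v ∈ V, v ≠ r → ∃! u, u ∈ V ∧ E u v) ∧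
  (∀ u ∈ V, ¬ E u r)

/-- A bow tie with center `(x, y)` (Definition 6.2): `V_x^{-y}` induces a directed tree on the
inverse edges rooted in `x`, `V_y^{-x}` induces a directed tree rooted in `y`, and the two
components partition `V`. -/
def IsBowTie {α : Type} (V : Set α) (E : α → α → Prop) (x y : α) : Prop :=
  x ∈ V ∧ y ∈ V ∧ E x y ∧
  IsDirTree (wcc (V \ {y}) E x) (fun u v => E v u) x ∧
  IsDirTree (wcc (V \ {x}) E y) E y ∧
  wcc (V \ {y}) E x ∩ wcc (V \ {x}) E y = ∅ ∧
  wcc (V \ {y}) E x ∪ wcc (V \ {x}) E y = V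

/-- `bowtie(A)` for a state atom `q(x, w)`: the weakly connected component of `x` in
`(semterms F, E_R)`. -/
def bowtieOf (F : Set Fact) (x : GroundTerm) : Set GroundTerm := wcc (semterms F) (ER F) x

/-- A maximal `E`-path in the vertex set `V`. -/
def IsMaxPath {α : Type} (V : Set α) (E : α → α → Prop) (l : List α) : Prop :=
  l ≠ [] ∧ (∀ z ∈ l, z ∈ V) ∧ List.Chain' E l ∧
  (∀ z ∈ V, ∀ a, l.head? = some a → ¬ E z a) ∧
  (∀ z ∈ V, ∀ a, l.getLast? = some a → ¬ E a z)

/-- `configs(A)` (Definition 6.4): one candidate configuration per maximal path of `bowtie(A)`. -/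
def configsOf (M : NTM) (F : Set Fact) (A : Fact) : Set (Set Fact) :=
  {S | ∃ q : ℕ, ∃ x w : GroundTerm, A = ((pState q, [x, w]) : Fact) ∧
    ∃ l : List GroundTerm, IsMaxPath (bowtieOf F x) (ER F) l ∧
      S = insert A
        ({f | ∃ z ∈ l, f ∈ brSetF z w} ∪
         {f | f ∈ F ∧ (f.1 = pR ∨ f.1 = pEnd ∨ ∃ a ∈ letters M, f.1 = pLetter a) ∧
           f.2 ≠ [] ∧ f.2.getLast? = some w ∧ ∀ z ∈ f.2.dropLast, z ∈ l})}

/-- Homomorphic embedding of fact sets: a map on nulls (fixing all constants) sending `S`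
into `T`. -/
def mapG (h : ℕ → GroundTerm) : GroundTerm → GroundTerm
  | Sum.inl cc => Sum.inl cc
  | Sum.inr n => h n

def mapFact (h : ℕ → GroundTerm) (f : Fact) : Fact := (f.1, f.2.map (mapG h))

def HomEmbeds (S T : Set Fact) : Prop := ∃ h : ℕ → GroundTerm, ∀ f ∈ S, mapFact h f ∈ T

end ChaseTermination
namespace ChaseTermination

/-! ### The machine `M_Σ` (Definition 4.1), modelled by its canonical runs

A run of `M_Σ` on the encoding of a database corresponds exactly to a restricted chase
derivation of `⟨Σ, D⟩` (step 4 of the procedure) together with the counter `j`; the machine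
visits its designated state `q_r` once each time `j` is incremented (step 5), so a run visits
`q_r` infinitely often iff the derivation is infinite and `jseq` is unbounded. -/

open scoped Classical in
/-- The value of the counter `j` of `M_Σ` after `i` iterations of its main loop, when its
non-deterministic choices build the chase derivation `c`. -/
noncomputable def jseq {S : RuleSet} {D : Set Fact} (c : Chase S D) : ℕ → ℕ
  | 0 => 0
  | i + 1 =>
      if ∀ t : Trigger, Active S (c.fact (jseq c i)) t → obsolete t (c.fact i) then
        jseq c i + 1
      else jseq c i

/-! ### Oblivious and core chase variants -/

/-- A (possibly infinite) oblivious chase derivation: triggers need only be loaded, but no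
trigger (instance) is ever applied twice. -/
structure OblChase (S : RuleSet) (D : Set Fact) where
  len : ℕ∞
  fact : ℕ → Set Fact
  trig : ℕ → Trigger
  ext : ℕ → ℕ → GroundTerm
  init : fact 0 = D
  memAt : ∀ i : ℕ, (i : ℕ∞) < len → (trig i).1 ∈ S
  loadAt : ∀ i : ℕ, (i : ℕ∞) < len → loaded (trig i) (fact i)
  noRepeat : ∀ i j : ℕ, (i : ℕ∞) < len → (j : ℕ∞) < len →
    instOf (trig i) = instOf (trig j) → i = j
  extOk : ∀ i : ℕ, (i : ℕ∞) < len → properExt (trig i) (fact i) (ext i)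
  succ : ∀ i : ℕ, (i : ℕ∞) < len → fact (i + 1) = fact i ∪ outputOf (trig i) (ext i)
  stall : ∀ i : ℕ, ¬ ((i : ℕ∞) < len) → fact (i + 1) = fact i

/-- Fairness for the oblivious chase: every trigger that becomes loaded is eventually applied. -/
def OblFair {S : RuleSet} {D : Set Fact} (c : OblChase S D) : Prop :=
  ∀ t : Trigger, t.1 ∈ S → ∀ i : ℕ, loaded t (c.fact i) →
    ∃ j : ℕ, (j : ℕ∞) < c.len ∧ instOf (c.trig j) = instOf t

/-- `H` is a retract of `G`: `H ⊆ G` and some homomorphism (fixing constants) maps `G` into `H`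
leaving `H` pointwise fixed. -/
def RetractOf (G H : Set Fact) : Prop :=
  H ⊆ G ∧ ∃ h : ℕ → GroundTerm, (∀ f ∈ G, mapFact h f ∈ H) ∧ ∀ f ∈ H, mapFact h f = f

/-- `H` is a core of `G`: a retract of `G` without proper retracts. -/
def IsCoreOf (H G : Set Fact) : Prop := RetractOf G H ∧ ∀ H', RetractOf H H' → H' = H

/-- `G` is obtained from `F` by applying all active triggers in parallel, each with fresh
pairwise distinct nulls (distinct trigger instances use disjoint fresh nulls). -/
def IsParallelStep (S : RuleSet) (F G : Set Fact) : Prop :=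
  ∃ pe : Trigger → (ℕ → GroundTerm),
    (∀ t : Trigger, Active S F t → properExt t F (pe t)) ∧
    (∀ t t' : Trigger, Active S F t → Active S F t' → instOf t = instOf t' →
      outputOf t (pe t) = outputOf t' (pe t')) ∧
    (∀ t t' : Trigger, Active S F t → Active S F t' → instOf t ≠ instOf t' →
      ∀ n : ℕ, (Sum.inr n : GroundTerm) ∉ termsOf F →
        (Sum.inr n : GroundTerm) ∈ termsOf (outputOf t (pe t)) →
        (Sum.inr n : GroundTerm) ∉ termsOf (outputOf t' (pe t'))) ∧
    G = F ∪ ⋃ t ∈ {t : Trigger | Active S F t}, outputOf t (pe t)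

/-- A (possibly infinite) core chase sequence: `F_{i+1}` is a core of the parallel application
of all active triggers to `F_i`, and the sequence stops exactly when this is a fixpoint. -/
structure CoreChase (S : RuleSet) (D : Set Fact) where
  len : ℕ∞
  fact : ℕ → Set Fact
  init : fact 0 = D
  step : ∀ i : ℕ, (i : ℕ∞) < len →
    ∃ G, IsParallelStep S (fact i) G ∧ IsCoreOf (fact (i + 1)) G ∧ fact (i + 1) ≠ fact i
  halt : ∀ i : ℕ, ¬ ((i : ℕ∞) < len) → ∃ G, IsParallelStep S (fact i) G ∧ IsCoreOf (fact i) G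
  stall : ∀ i : ℕ, ¬ ((i : ℕ∞) < len) → fact (i + 1) = fact i

/-- The three chase variants. -/
inductive Variant : Type | obl | rest | core

/-- `qExists` ("sometimes") and `qForall` ("always") termination. -/
inductive Quant : Type | qExists | qForall

/-- `Terminates v q S D`: the knowledge base `⟨S, D⟩` `q`-terminates for the chase variant `v`
(`qExists`: some chase sequence is finite; `qForall`: all chase sequences are finite). -/
def Terminates (v : Variant) (q : Quant) (S : RuleSet) (D : Set Fact) : Prop :=
  match v, q with
  | .rest, .qExists => ∃ c : Chase S D, Fair c ∧ c.len ≠ ⊤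
  | .rest, .qForall => ∀ c : Chase S D, Fair c → c.len ≠ ⊤
  | .obl, .qExists => ∃ c : OblChase S D, OblFair c ∧ c.len ≠ ⊤
  | .obl, .qForall => ∀ c : OblChase S D, OblFair c → c.len ≠ ⊤
  | .core, .qExists => ∃ c : CoreChase S D, c.len ≠ ⊤
  | .core, .qForall => ∀ c : CoreChase S D, c.len ≠ ⊤

end ChaseTermination

namespace ChaseTermination

/-! ### Nondeterministic counter programs -/

/-- The contents of the counters of a counter machine. -/
abbrev Store : Type := ℕ → ℕ

/-- The instructions of a counter machine. -/
inductive Op : Type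
  | nop
  | inc (i : ℕ)
  | dec (i : ℕ)
  | zero (i : ℕ)

/-- The effect of an instruction; decrements of `0` and failed zero tests block. -/
def Op.Rel : Op → Store → Store → Prop
  | nop, s, s' => s' = s
  | inc i, s, s' => s' = Function.update s i (s i + 1)
  | dec i, s, s' => s = Function.update s' i (s' i + 1)
  | zero i, s, s' => s i = 0 ∧ s' = s

/-- Regular programs over counter instructions. -/
inductive Prog : Type
  | atom (o : Op)
  | seq (p q : Prog)
  | alt (p q : Prog)
  | star (p : Prog)

/-- The input-output relation of a program. -/
def Prog.Rel : Prog → Store → Store → Prop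
  | atom o => o.Rel
  | seq p q => Relation.Comp p.Rel q.Rel
  | alt p q => fun s s' => p.Rel s s' ∨ q.Rel s s'
  | star p => Relation.ReflTransGen p.Rel

/-- `P` runs exactly from the stores satisfying `A`, and preserves the counters below `m`. -/
def Prog.Checks (P : Prog) (m : ℕ) (A : Store → Prop) : Prop :=
  (∀ s s', P.Rel s s' → A s ∧ ∀ i < m, s' i = s i) ∧ ∀ s, A s → ∃ s', P.Rel s s'

/-- A relation is checkable if, for all locations of its arguments, some program checks it. -/
def Checkable {α : Type} (A : (α → ℕ) → Prop) : Prop :=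
  ∀ (v : α → ℕ) (m : ℕ), (∀ a, v a < m) → ∃ P : Prog, P.Checks m fun s => A fun a => s (v a)

/-- Sets counter `m` to an arbitrary value. -/
def Prog.guess (m : ℕ) : Prog := seq (star (atom (.dec m))) (star (atom (.inc m)))

theorem Prog.guess_sound {m : ℕ} {s s' : Store} (h : (guess m).Rel s s') :
    ∀ i, i ≠ m → s' i = s i := by
  obtain ⟨t, h₁, h₂⟩ := h
  have h₁ : ∀ i, i ≠ m → t i = s i := by
    clear h₂
    induction h₁ with
    | refl => simp
    | tail _ h ih =>
      intro i hi
      have := congrFun h i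
      rw [Function.update_of_ne hi] at this
      rw [← this, ih i hi]
  induction h₂ with
  | refl => exact h₁
  | tail _ h ih =>
    intro i hi
    have := congrFun h i
    rw [Function.update_of_ne hi] at this
    rw [this, ih i hi]

theorem Prog.guess_complete (m n : ℕ) (s : Store) :
    (guess m).Rel s (Function.update s m n) := by
  refine ⟨Function.update s m 0, ?_, ?_⟩
  · have : ∀ k, Relation.ReflTransGen (atom (.dec m)).Rel (Function.update s m k)
        (Function.update s m 0) := by
      intro k
      induction k with
      | zero => exact .refl
      | succ k ih => exact .head (by simp [Rel, Op.Rel]) ih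
    have := this (s m)
    rw [Function.update_eq_self] at this
    exact this
  · induction n with
    | zero => exact .refl
    | succ k ih => exact .tail ih (by simp [Rel, Op.Rel])

namespace Checkable

variable {α : Type}

theorem of_iff {A B : (α → ℕ) → Prop} (hA : Checkable A) (h : ∀ w, B w ↔ A w) : Checkable B := by
  have : B = A := funext fun w => propext (h w)
  rwa [this]

theorem and {A B : (α → ℕ) → Prop} (hA : Checkable A) (hB : Checkable B) :
    Checkable fun w => A w ∧ B w := by
  intro v m hv
  obtain ⟨P, hP, hP'⟩ := hA v m hv
  obtain ⟨Q, hQ, hQ'⟩ := hB v m hv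
  beta_reduce at hP hP' hQ hQ'
  have key : ∀ s t, P.Rel s t → (fun a => t (v a)) = fun a => s (v a) := fun s t h =>
    funext fun a => (hP _ _ h).2 _ (hv a)
  refine ⟨.seq P Q, ?_, ?_⟩
  · rintro s s' ⟨t, h₁, h₂⟩
    refine ⟨⟨(hP _ _ h₁).1, ?_⟩, fun i hi => ((hQ _ _ h₂).2 i hi).trans ((hP _ _ h₁).2 i hi)⟩
    have := (hQ _ _ h₂).1
    rwa [key _ _ h₁] at this
  · rintro s ⟨h₁, h₂⟩
    obtain ⟨t, ht⟩ := hP' s h₁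
    obtain ⟨t', ht'⟩ := hQ' t (by rwa [key _ _ ht])
    exact ⟨t', t, ht, ht'⟩

theorem or {A B : (α → ℕ) → Prop} (hA : Checkable A) (hB : Checkable B) :
    Checkable fun w => A w ∨ B w := by
  intro v m hv
  obtain ⟨P, hP, hP'⟩ := hA v m hv
  obtain ⟨Q, hQ, hQ'⟩ := hB v m hv
  beta_reduce at hP hP' hQ hQ'
  refine ⟨.alt P Q, ?_, ?_⟩
  · rintro s s' (h | h)
    · exact ⟨.inl (hP _ _ h).1, (hP _ _ h).2⟩
    · exact ⟨.inr (hQ _ _ h).1, (hQ _ _ h).2⟩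
  · rintro s (h | h)
    · exact (hP' s h).imp fun _ => .inl
    · exact (hQ' s h).imp fun _ => .inr

theorem ex {A : (α → ℕ) → ℕ → Prop}
    (hA : Checkable fun w : Option α → ℕ => A (fun a => w (some a)) (w none)) :
    Checkable fun w => ∃ n, A w n := by
  intro v m hv
  obtain ⟨P, hP, hP'⟩ := hA (fun o => o.elim m v) (m + 1) (by
    rintro (_ | a)
    · simp
    · simpa using (hv a).trans (Nat.lt_succ_self m))
  refine ⟨.seq (.guess m) P, ?_, ?_⟩
  · rintro s s' ⟨t, h₁, h₂⟩
    have h₁ := Prog.guess_sound h₁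
    obtain ⟨h₃, h₄⟩ := hP _ _ h₂
    have : (fun a => t (v a)) = fun a => s (v a) := funext fun a => h₁ _ (hv a).ne
    refine ⟨⟨t m, ?_⟩, fun i hi => ?_⟩
    · simpa [this] using h₃
    · rw [h₄ i (by omega), h₁ i (by omega)]
  · rintro s ⟨n, hn⟩
    obtain ⟨s', h⟩ := hP' (Function.update s m n) (by
      have : (fun a => Function.update s m n (v a)) = fun a => s (v a) :=
        funext fun a => Function.update_of_ne (hv a).ne _ _
      simpa [this] using hn)
    exact ⟨s', _, Prog.guess_complete m n s, h⟩

theorem eq_zero (a : α) : Checkable fun w => w a = 0 := by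
  intro v m _
  refine ⟨.atom (.zero (v a)), ?_, fun s hs => ⟨s, hs, rfl⟩⟩
  rintro s s' ⟨h, rfl⟩
  exact ⟨h, fun _ _ => rfl⟩

theorem const_false : Checkable fun _ : α → ℕ => False := by
  intro v m _
  refine ⟨.seq (.atom (.inc m)) (.atom (.zero m)), ?_, fun s hs => hs.elim⟩
  rintro s s' ⟨t, h₁, h₂, -⟩
  have := congrFun h₁ m
  simp [h₂] at this

theorem const_true : Checkable fun _ : α → ℕ => True := by
  intro v m _
  refine ⟨.atom .nop, ?_, fun s _ => ⟨s, rfl⟩⟩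
  rintro s s' rfl
  exact ⟨trivial, fun _ _ => rfl⟩

theorem eq (a b : α) : Checkable fun w => w a = w b := by
  intro v m hv
  have ha := hv a
  have hb := hv b
  change ∃ P : Prog, P.Checks m fun s => s (v a) = s (v b)
  generalize v a = i at *
  generalize v b = j at *
  by_cases hij : i = j
  · subst hij
    obtain ⟨P, hP, hP'⟩ := const_true v m hv
    exact ⟨P, fun s s' h => ⟨rfl, (hP s s' h).2⟩, fun s _ => hP' s trivial⟩
  let down : Prog := .seq (.atom (.dec i)) (.seq (.atom (.dec j)) (.atom (.inc m)))
  let up : Prog := .seq (.atom (.dec m)) (.seq (.atom (.inc i)) (.atom (.inc j)))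
  let I : Store → Store → Prop := fun s t =>
    t i + t m = s i + s m ∧ t j + t m = s j + s m ∧ ∀ x < m, x ≠ i → x ≠ j → t x = s x
  have Itrans : ∀ {s t u}, I s t → I t u → I s u := by
    rintro s t u ⟨h₁, h₂, h₃⟩ ⟨h₄, h₅, h₆⟩
    exact ⟨h₄.trans h₁, h₅.trans h₂, fun x h h' h'' => (h₆ x h h' h'').trans (h₃ x h h' h'')⟩
  have Istar : ∀ P : Prog, (∀ s t, P.Rel s t → I s t) → ∀ s t, (Prog.star P).Rel s t → I s t := by
    intro P hP s t h
    induction h with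
    | refl => exact ⟨rfl, rfl, fun _ _ _ _ => rfl⟩
    | tail _ h ih => exact Itrans ih (hP _ _ h)
  have Idown : ∀ s t, down.Rel s t → I s t := by
    rintro s t ⟨s₁, h₁, s₂, h₂, h₃⟩
    simp only [Prog.Rel, Op.Rel] at h₁ h₂ h₃
    subst h₃ h₂ h₁
    refine ⟨?_, ?_, fun x h h' h'' => ?_⟩ <;> simp only [Function.update_apply] <;>
      split_ifs <;> omega
  have Iup : ∀ s t, up.Rel s t → I s t := by
    rintro s t ⟨s₁, h₁, s₂, h₂, h₃⟩
    simp only [Prog.Rel, Op.Rel] at h₁ h₂ h₃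
    subst h₃ h₂ h₁
    refine ⟨?_, ?_, fun x h h' h'' => ?_⟩ <;> simp only [Function.update_apply] <;>
      split_ifs <;> omega
  refine ⟨.seq (.guess m) (.seq (.atom (.zero m)) (.seq (.star down) (.seq (.atom (.zero i))
    (.seq (.atom (.zero j)) (.seq (.star up) (.atom (.zero m))))))), ?_, ?_⟩
  · rintro s s' ⟨s₁, h₁, _, ⟨h₂, rfl⟩, s₃, h₃, _, ⟨h₄, rfl⟩, _, ⟨h₅, rfl⟩, s₆, h₆, h₇, rfl⟩
    have h₁ := Prog.guess_sound h₁
    obtain ⟨d₁, d₂, d₃⟩ := Istar _ Idown _ _ h₃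
    obtain ⟨e₁, e₂, e₃⟩ := Istar _ Iup _ _ h₆
    have hi := h₁ i ha.ne
    have hj := h₁ j hb.ne
    refine ⟨by omega, fun x hx => ?_⟩
    by_cases hxi : x = i
    · subst hxi; omega
    by_cases hxj : x = j
    · subst hxj; omega
    rw [e₃ x hx hxi hxj, d₃ x hx hxi hxj, h₁ x hx.ne]
  · intro s hs
    let S : ℕ → ℕ → Store := fun x y =>
      Function.update (Function.update (Function.update s i x) j x) m y
    have hdown : ∀ n y, (Prog.star down).Rel (S n y) (S 0 (y + n)) := by
      intro n
      induction n with
      | zero => intro y; exact .refl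
      | succ n ih =>
        intro y
        rw [show y + (n + 1) = y + 1 + n by omega]
        refine .head ?_ (ih (y + 1))
        refine ⟨Function.update (S (n + 1) y) i n, ?_, S n y, ?_, ?_⟩ <;>
        · simp only [Prog.Rel, Op.Rel, S]
          funext x
          simp only [Function.update_apply]
          split_ifs <;> omega
    have hup : ∀ n y, (Prog.star up).Rel (S y n) (S (y + n) 0) := by
      intro n
      induction n with
      | zero => intro y; exact .refl
      | succ n ih =>
        intro y
        rw [show y + (n + 1) = y + 1 + n by omega]
        refine .head ?_ (ih (y + 1))
        refine ⟨S y n, ?_, Function.update (S y n) i (y + 1), ?_, ?_⟩ <;>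
        · simp only [Prog.Rel, Op.Rel, S]
          funext x
          simp only [Function.update_apply]
          split_ifs <;> omega
    refine ⟨S (s i) 0, S (s i) 0, ?_, _, ⟨?_, rfl⟩, S 0 (s i), ?_, _, ⟨?_, rfl⟩, _, ⟨?_, rfl⟩,
      S (s i) 0, ?_, ?_, rfl⟩
    · have : S (s i) 0 = Function.update s m 0 := by
        funext x
        simp only [S, Function.update_apply]
        split_ifs <;> simp_all
      rw [this]
      exact Prog.guess_complete m 0 s
    · simp [S]
    · simpa using hdown (s i) 0
    · simp only [S, Function.update_apply]; split_ifs <;> omega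
    · simp only [S, Function.update_apply]; split_ifs <;> omega
    · simpa using hup (s i) 0
    · simp [S]

theorem eq_succ (a b : α) : Checkable fun w => w b = w a + 1 := by
  intro v m hv
  by_cases hab : v a = v b
  · obtain ⟨P, hP⟩ := const_false v m hv
    refine ⟨P, ?_⟩
    simpa [hab] using hP
  obtain ⟨P, hP, hP'⟩ := eq a b v m hv
  beta_reduce at hP hP' ⊢
  refine ⟨.seq (.atom (.dec (v b))) (.seq P (.atom (.inc (v b)))), ?_, ?_⟩
  · rintro s s' ⟨s₁, h₁, s₂, h₂, h₃⟩
    simp only [Prog.Rel, Op.Rel] at h₁ h₃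
    obtain ⟨h₄, h₅⟩ := hP _ _ h₂
    subst h₁ h₃
    have h₆ := h₅ _ (hv b)
    simp only [Function.update_apply]
    refine ⟨by split_ifs <;> omega, fun i hi => ?_⟩
    have := h₅ i hi
    split_ifs with h
    · subst h; omega
    · exact this
  · intro s hs
    obtain ⟨t, ht⟩ := hP' (Function.update s (v b) (s (v a))) (by simp [Function.update_of_ne hab])
    refine ⟨_, _, ?_, t, ht, rfl⟩
    simp [Prog.Rel, Op.Rel, ← hs]

end Checkable

/-- `Iter S n u v`: some sequence `u = x₀, …, xₙ = v` satisfies `S i xᵢ xᵢ₊₁` for all `i < n`. -/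
def Iter (S : ℕ → ℕ → ℕ → Prop) : ℕ → ℕ → ℕ → Prop
  | 0, u, v => v = u
  | n + 1, u, v => ∃ t, Iter S n u t ∧ S n t v

theorem Checkable.iter {α : Type} {S : (α → ℕ) → ℕ → ℕ → ℕ → Prop}
    (hS : Checkable fun w : Option (Option (Option α)) → ℕ =>
      S (fun a => w (some (some (some a)))) (w (some (some none))) (w (some none)) (w none))
    (a b c : α) : Checkable fun w => Iter (S w) (w a) (w b) (w c) := by
  intro v m hv
  obtain ⟨P, hP, hP'⟩ := hS
    (fun o => o.elim (m + 2) fun o => o.elim (m + 1) fun o => o.elim m v) (m + 3) (by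
      rintro (_ | _ | _ | x)
      · simp
      · simp
      · simp
      · have := hv x; simp; omega)
  have eqAt : ∀ i j, i < m + 3 → j < m + 3 →
      ∃ E : Prog, E.Checks (m + 3) fun s => s i = s j := by
    intro i j hi hj
    obtain ⟨E, hE⟩ := Checkable.eq true false (fun x => cond x i j) (m + 3) (by
      rintro (_ | _) <;> simp [hi, hj])
    exact ⟨E, hE⟩
  beta_reduce at hP hP'
  have ha := hv a
  have hb := hv b
  have hc := hv c
  obtain ⟨Eb, hEb, hEb'⟩ := eqAt (m + 1) (v b) (by omega) (by omega)
  obtain ⟨Et, hEt, hEt'⟩ := eqAt (m + 1) (m + 2) (by omega) (by omega)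
  obtain ⟨Ea, hEa, hEa'⟩ := eqAt m (v a) (by omega) (by omega)
  obtain ⟨Ec, hEc, hEc'⟩ := eqAt (m + 1) (v c) (by omega) (by omega)
  beta_reduce at hEb hEb' hEt hEt' hEa hEa' hEc hEc'
  let body : Prog :=
    .seq (.guess (m + 2)) (.seq P (.seq (.guess (m + 1)) (.seq Et (.atom (.inc m)))))
  have body_sound : ∀ s s', body.Rel s s' →
      S (fun x => s (v x)) (s m) (s (m + 1)) (s' (m + 1)) ∧ s' m = s m + 1 ∧
        ∀ i < m, s' i = s i := by
    rintro s s' ⟨s₁, h₁, s₂, h₂, s₃, h₃, s₄, h₄, h₅⟩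
    have h₁ := Prog.guess_sound h₁
    obtain ⟨h₂, h₂'⟩ := hP _ _ h₂
    have h₃ := Prog.guess_sound h₃
    obtain ⟨h₄, h₄'⟩ := hEt _ _ h₄
    simp only [Prog.Rel, Op.Rel] at h₅
    subst h₅
    have e : ∀ i, i ≠ m + 1 → i ≠ m + 2 → i < m + 3 → s₄ i = s i := fun i hi hi' hi'' => by
      rw [h₄' i hi'', h₃ i hi, h₂' i hi'', h₁ i hi']
    refine ⟨?_, ?_, fun i hi => ?_⟩
    · have e₁ : Function.update s₄ m (s₄ m + 1) (m + 1) = s₁ (m + 2) := by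
        rw [Function.update_of_ne (by omega), h₄' _ (by omega), h₄, h₃ _ (by omega),
          h₂' _ (by omega)]
      rw [e₁]
      have e₂ : (fun x => s (v x)) = fun x => s₁ (v x) := funext fun x => by
        have := hv x
        rw [h₁ _ (by omega)]
      rw [e₂, ← h₁ m (by omega), ← h₁ (m + 1) (by omega)]
      exact h₂
    · simp [e m (by omega) (by omega) (by omega)]
    · rw [Function.update_of_ne (by omega), e i (by omega) (by omega) (by omega)]
  have body_complete : ∀ s t, S (fun x => s (v x)) (s m) (s (m + 1)) t →
      ∃ s', body.Rel s s' ∧ s' (m + 1) = t := by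
    intro s t h
    obtain ⟨s₂, h₂⟩ := hP' (Function.update s (m + 2) t) (by
      have e₂ : (fun x => Function.update s (m + 2) t (v x)) = fun x => s (v x) :=
        funext fun x => by
          have := hv x
          rw [Function.update_of_ne (by omega)]
      simpa [e₂] using h)
    obtain ⟨s₄, h₄⟩ := hEt' (Function.update s₂ (m + 1) t) (by
      have := (hP _ _ h₂).2 (m + 2) (by omega)
      simpa using this.symm)
    refine ⟨_, ⟨_, Prog.guess_complete _ t s, s₂, h₂, _, Prog.guess_complete _ t s₂, s₄, h₄, rfl⟩,
      ?_⟩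
    rw [Function.update_of_ne (by omega), (hEt _ _ h₄).2 _ (by omega)]
    simp
  refine ⟨.seq (.guess m) (.seq (.atom (.zero m)) (.seq (.guess (m + 1)) (.seq Eb
    (.seq (.star body) (.seq Ea Ec))))), ?_, ?_⟩
  · rintro s s' ⟨s₁, h₁, _, ⟨h₂, rfl⟩, s₂, h₃, s₃, h₄, s₄, h₅, s₅, h₆, h₇⟩
    have h₁ := Prog.guess_sound h₁
    have h₃ := Prog.guess_sound h₃
    obtain ⟨h₄, h₄'⟩ := hEb _ _ h₄
    have e₃ : ∀ i < m, s₃ i = s i := fun i hi => by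
      rw [h₄' i (by omega), h₃ i (by omega), h₁ i (by omega)]
    have hstar : Iter (S fun x => s (v x)) (s₄ m) (s (v b)) (s₄ (m + 1)) ∧
        ∀ i < m, s₄ i = s i := by
      clear h₆ h₇
      induction h₅ with
      | refl =>
        refine ⟨?_, e₃⟩
        rw [h₄' m (by omega), h₃ m (by omega), h₂]
        simp only [Iter]
        rw [← e₃ _ hb, h₄' _ (by omega), h₄, h₄' _ (by omega)]
      | tail _ h ih =>
        obtain ⟨i₁, i₂⟩ := ih
        obtain ⟨j₁, j₂, j₃⟩ := body_sound _ _ h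
        refine ⟨?_, fun i hi => (j₃ i hi).trans (i₂ i hi)⟩
        rw [j₂]
        refine ⟨_, i₁, ?_⟩
        have : (fun x => s (v x)) = fun x => _ := funext fun x => (i₂ _ (hv x)).symm
        rw [this]
        exact j₁
    obtain ⟨h₆, h₆'⟩ := hEa _ _ h₆
    obtain ⟨h₇, h₇'⟩ := hEc _ _ h₇
    obtain ⟨k₁, k₂⟩ := hstar
    rw [h₆' _ (by omega), h₆' _ (by omega), k₂ _ hc] at h₇
    rw [h₆, k₂ _ ha, h₇] at k₁
    exact ⟨k₁, fun i hi => by rw [h₇' i (by omega), h₆' i (by omega), k₂ i hi]⟩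
  · intro s hs
    obtain ⟨s₃, h₃⟩ := hEb' (Function.update (Function.update s m 0) (m + 1) (s (v b))) (by
      rw [Function.update_self, Function.update_of_ne (by omega),
        Function.update_of_ne (by omega)])
    have e₃ := (hEb _ _ h₃).2
    have e₃' : ∀ i < m, s₃ i = s i := fun i hi => by
      rw [e₃ i (by omega), Function.update_of_ne (by omega), Function.update_of_ne (by omega)]
    have hstar : ∀ n t, Iter (S fun x => s (v x)) n (s (v b)) t →
        ∃ s', (Prog.star body).Rel s₃ s' ∧ s' m = n ∧ s' (m + 1) = t ∧ ∀ i < m, s' i = s i := by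
      intro n
      induction n with
      | zero =>
        rintro t rfl
        refine ⟨s₃, .refl, ?_, ?_, e₃'⟩
        · rw [e₃ m (by omega), Function.update_of_ne (by omega), Function.update_self]
        · rw [e₃ _ (by omega), Function.update_self]
      | succ n ih =>
        rintro t ⟨u, hu, hS⟩
        obtain ⟨s₄, h₁, rfl, rfl, h₄⟩ := ih u hu
        obtain ⟨s₅, h₅, rfl⟩ := body_complete s₄ t (by
          have : (fun x => s₄ (v x)) = fun x => s (v x) := funext fun x => h₄ _ (hv x)
          rw [this]
          exact hS)
        obtain ⟨-, j₂, j₃⟩ := body_sound _ _ h₅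
        exact ⟨s₅, .tail h₁ h₅, j₂, rfl, fun i hi => (j₃ i hi).trans (h₄ i hi)⟩
    obtain ⟨s₄, h₄, k₁, k₂, k₃⟩ := hstar _ _ hs
    obtain ⟨s₅, h₅⟩ := hEa' s₄ (by rw [k₁, k₃ _ ha])
    have e₅ := (hEa _ _ h₅).2
    obtain ⟨s₆, h₆⟩ := hEc' s₅ (by rw [e₅ _ (by omega), e₅ _ (by omega), k₂, k₃ _ hc])
    refine ⟨s₆, _, Prog.guess_complete m 0 s, _, ⟨by simp, rfl⟩, _,
      Prog.guess_complete (m + 1) (s (v b)) _, s₃, h₃, s₄, h₄, s₅, h₅, h₆⟩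

/-! ### Graphs of partial recursive functions -/

namespace Checkable

variable {α : Type}

theorem eq_add (a b c : α) : Checkable fun w => w c = w a + w b := by
  refine of_iff (iter (S := fun _ _ u v => v = u + 1) (eq_succ _ _) b a c) fun w => ?_
  have : ∀ n u v, Iter (fun _ u v => v = u + 1) n u v ↔ v = u + n := by
    intro n
    induction n with
    | zero => simp [Iter]
    | succ n ih => simp [Iter, ih, add_assoc]
  rw [this]

theorem mul (a b c : α) : Checkable fun w => w c = w a * w b := by
  have h : Checkable fun w : Option α → ℕ => w none = 0 ∧
      Iter (fun _ u v => v = u + w (some a)) (w (some b)) (w none) (w (some c)) :=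
    and (eq_zero _) (iter (S := fun w _ u v => v = u + w (some a)) (eq_add _ _ _) _ _ _)
  refine of_iff (ex (A := fun w z => z = 0 ∧ Iter (fun _ u v => v = u + w a) (w b) z (w c)) h)
    fun w => ?_
  have : ∀ n u v, Iter (fun _ u v => v = u + w a) n u v ↔ v = u + w a * n := by
    intro n
    induction n with
    | zero => simp [Iter]
    | succ n ih => simp [Iter, ih, add_assoc, mul_add]
  simp [this]

theorem le (a b : α) : Checkable fun w => w a ≤ w b :=
  of_iff (ex (A := fun w z => w b = w a + z) (eq_add _ _ _)) fun _ => le_iff_exists_add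

theorem lt (a b : α) : Checkable fun w => w a < w b :=
  of_iff (ex (A := fun w z => z = w a + 1 ∧ z ≤ w b) (and (eq_succ _ _) (le _ _))) fun _ => by
    simp

theorem pair (a b c : α) : Checkable fun w => w c = Nat.pair (w a) (w b) := by
  refine of_iff (or
    (and (lt a b) (ex (A := fun w z => z = w b * w b ∧ w c = z + w a)
      (and (mul _ _ _) (eq_add _ _ _))))
    (and (le b a) (ex (A := fun w z => z = w a * w a ∧ ∃ y, y = z + w a ∧ w c = y + w b)
      (and (mul _ _ _) (ex (and (eq_add (some none) (some (some a)) none)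
        (eq_add none (some (some b)) (some (some c)))))))))
    fun w => ?_
  rw [Nat.pair]
  split_ifs with h
  · simp [h, h.not_ge]
  · simp [h, not_lt.1 h]

/-- A partial function has a checkable graph. -/
def _root_.ChaseTermination.CheckableGraph (f : ℕ →. ℕ) : Prop :=
  ∀ {α : Type} (a b : α), Checkable fun w => w b ∈ f (w a)

end Checkable

namespace CheckableGraph

open Checkable

theorem comp {f g : ℕ →. ℕ} (hf : CheckableGraph f) (hg : CheckableGraph g) :
    CheckableGraph fun n => g n >>= f := fun a b =>
  of_iff (ex (A := fun w z => z ∈ g (w a) ∧ w b ∈ f z) (and (hg _ _) (hf _ _)))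
    fun _ => Part.mem_bind_iff

theorem pair {f g : ℕ →. ℕ} (hf : CheckableGraph f) (hg : CheckableGraph g) :
    CheckableGraph fun n => Nat.pair <$> f n <*> g n := fun a b =>
  of_iff (ex (A := fun w y => ∃ z, (y ∈ f (w a) ∧ z ∈ g (w a)) ∧ w b = Nat.pair y z)
    (ex (and (and (hf (some (some a)) (some none)) (hg (some (some a)) none))
      (Checkable.pair (some none) none (some (some b)))))) fun w => by
    simp only [Seq.seq, Part.map_eq_map, Part.mem_bind_iff, Part.mem_map_iff]
    constructor
    · rintro ⟨_, ⟨y, hy, rfl⟩, z, hz, h⟩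
      exact ⟨y, z, ⟨hy, hz⟩, h.symm⟩
    · rintro ⟨y, z, ⟨hy, hz⟩, h⟩
      exact ⟨_, ⟨y, hy, rfl⟩, z, hz, h.symm⟩

theorem prec {f g : ℕ →. ℕ} (hf : CheckableGraph f) (hg : CheckableGraph g) :
    CheckableGraph (Nat.unpaired fun a n =>
      n.rec (f a) fun y IH => do let i ← IH; g (Nat.pair a (Nat.pair y i))) := by
  intro α a b
  let S : ℕ → ℕ → ℕ → ℕ → Prop := fun x i u v =>
    ∃ p, p = Nat.pair i u ∧ ∃ q, q = Nat.pair x p ∧ v ∈ g q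
  have hS : ∀ {β : Type} (x i u v : β), Checkable fun w => S (w x) (w i) (w u) (w v) :=
    fun x i u v => ex (and (Checkable.pair (some i) (some u) none)
      (ex (and (Checkable.pair (some (some x)) (some none) none) (hg none (some (some v))))))
  refine of_iff (ex (A := fun w x => ∃ n u, (w a = Nat.pair x n ∧ u ∈ f x) ∧ Iter (S x) n u (w b))
    (ex (ex (and (and (Checkable.pair (some (some none)) (some none) (some (some (some a))))
      (hf (some (some none)) none))
        (iter (S := fun w => S (w (some (some none)))) (hS _ _ _ _) _ _ _))))) fun w => ?_
  have key : ∀ x n v, v ∈ (n.rec (f x) fun y IH => IH >>= fun i => g (Nat.pair x (Nat.pair y i)) :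
      Part ℕ) ↔ ∃ u, u ∈ f x ∧ Iter (S x) n u v := by
    intro x n
    induction n with
    | zero => simp [Iter]
    | succ n ih =>
      intro v
      simp only [Part.bind_eq_bind, Part.mem_bind_iff] at ih ⊢
      simp only [ih, Iter, S]
      grind
  simp only [Nat.unpaired]
  rw [key]
  constructor
  · rintro ⟨u, h₁, h₂⟩
    exact ⟨_, _, u, ⟨(Nat.pair_unpair _).symm, h₁⟩, h₂⟩
  · rintro ⟨x, n, u, ⟨h₁, h₂⟩, h₃⟩
    rw [h₁, Nat.unpair_pair]
    exact ⟨u, h₂, h₃⟩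

theorem rfind {f : ℕ →. ℕ} (hf : CheckableGraph f) :
    CheckableGraph fun a => Nat.rfind fun n => (fun m => m = 0) <$> f (Nat.pair a n) := by
  intro α a b
  let S : ℕ → ℕ → ℕ → ℕ → Prop := fun x i u v => v = u ∧
    ∃ p, p = Nat.pair x i ∧ ∃ y, y ∈ f p ∧ ∃ z, y = z + 1
  have hS : ∀ {β : Type} (x i u v : β), Checkable fun w => S (w x) (w i) (w u) (w v) :=
    fun x i u v => and (eq v u) (ex (and (Checkable.pair (some x) (some i) none)
      (ex (and (hf (some none) none) (ex (eq_succ none (some none)))))))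
  refine of_iff (and (ex (A := fun w p => p = Nat.pair (w a) (w b) ∧ ∃ y, y ∈ f p ∧ y = 0)
    (and (Checkable.pair (some a) (some b) none) (ex (and (hf (some none) none) (eq_zero none)))))
    (iter (S := fun w => S (w a)) (hS _ _ _ _) b b b)) fun w => ?_
  have key : ∀ n u v, Iter (S (w a)) n u v ↔
      v = u ∧ ∀ i < n, ∃ z, z + 1 ∈ f (Nat.pair (w a) i) := by
    intro n
    induction n with
    | zero => simp [Iter]
    | succ n ih =>
      intro u v
      simp only [Iter, ih, S, Nat.forall_lt_succ_right]
      constructor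
      · rintro ⟨_, ⟨rfl, h⟩, rfl, _, rfl, _, hy, z, rfl⟩
        exact ⟨rfl, h, z, hy⟩
      · rintro ⟨rfl, h, z, hz⟩
        exact ⟨_, ⟨rfl, h⟩, rfl, _, rfl, _, hz, z, rfl⟩
  rw [key]
  refine Nat.mem_rfind.trans ?_
  simp only [Part.map_eq_map, Part.mem_map_iff]
  constructor
  · rintro ⟨h₁, h₂⟩
    refine ⟨by simpa using h₁, trivial, fun i hi => ?_⟩
    obtain ⟨y, hy, hy'⟩ := h₂ hi
    obtain ⟨z, rfl⟩ := Nat.exists_eq_succ_of_ne_zero (by simpa using hy')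
    exact ⟨z, hy⟩
  · rintro ⟨h₁, -, h₂⟩
    refine ⟨by simpa using h₁, fun hi => ?_⟩
    obtain ⟨z, hz⟩ := h₂ _ hi
    exact ⟨_, hz, by simp⟩

end CheckableGraph

theorem _root_.Nat.Partrec.checkableGraph {f : ℕ →. ℕ} (hf : Nat.Partrec f) :
    CheckableGraph f := by
  open Checkable in
  induction hf with
  | zero => exact fun a b => of_iff (eq_zero b) fun w => by simp [pure, PFun.pure]
  | succ => exact fun a b => of_iff (eq_succ a b) fun w => by simp
  | left =>
    exact fun a b => of_iff (ex (A := fun w z => w a = Nat.pair (w b) z) (Checkable.pair _ _ _))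
      fun w => ⟨fun h => ⟨(w a).unpair.2, by simp_all⟩, fun ⟨z, h⟩ => by simp [h]⟩
  | right =>
    exact fun a b => of_iff (ex (A := fun w z => w a = Nat.pair z (w b)) (Checkable.pair _ _ _))
      fun w => ⟨fun h => ⟨(w a).unpair.1, by simp_all⟩, fun ⟨z, h⟩ => by simp [h]⟩
  | pair _ _ hf hg => exact hf.pair hg
  | comp _ _ hf hg => exact hf.comp hg
  | prec _ _ hf hg => exact hf.prec hg
  | rfind _ hf => exact hf.rfind

/-! ### Infinite chains of a relation -/

/-- `Steps r n x y`: there is an `r`-path of length `n` from `x` to `y`. -/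
def Steps {α : Type} (r : α → α → Prop) : ℕ → α → α → Prop
  | 0, x, y => x = y
  | n + 1, x, y => ∃ z, r x z ∧ Steps r n z y

theorem Steps.of_reflTransGen {α : Type} {r : α → α → Prop} {x y : α}
    (h : Relation.ReflTransGen r x y) : ∃ n, Steps r n x y := by
  induction h using Relation.ReflTransGen.head_induction_on with
  | refl => exact ⟨0, rfl⟩
  | head h _ ih =>
    obtain ⟨n, hn⟩ := ih
    exact ⟨n + 1, _, h, hn⟩

theorem exists_recurring_chain {α : Type} {r : α → α → Prop} {P : α → Prop} (Rep : ℕ → α → Prop)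
    (h : ∀ i x, Rep i x → P x ∧ ∃ y, Rep (i + 1) y ∧ Relation.TransGen r x y)
    {x : α} (hx : Rep 0 x) :
    ∃ c : ℕ → α, c 0 = x ∧ (∀ i, r (c i) (c (i + 1))) ∧ ∀ N, ∃ i ≥ N, P (c i) := by
  let V := {v : α × ℕ // ∃ i y, Rep i y ∧ Steps r v.2 v.1 y}
  have step : ∀ v : V, ∃ v' : V, r v.1.1 v'.1.1 ∧ (v.1.2 = 0 → P v.1.1) ∧
      (v.1.2 ≠ 0 → v'.1.2 < v.1.2) := by
    rintro ⟨⟨b, n⟩, i, y, hy, hn⟩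
    cases n with
    | zero =>
      obtain rfl : b = y := hn
      obtain ⟨hP, y, hy, ht⟩ := h i b hy
      obtain ⟨z, hz, hzy⟩ := Relation.TransGen.head'_iff.1 ht
      obtain ⟨n, hn⟩ := Steps.of_reflTransGen hzy
      exact ⟨⟨(z, n), i + 1, y, hy, hn⟩, hz, fun _ => hP, fun h => (h rfl).elim⟩
    | succ n =>
      obtain ⟨z, hz, hn⟩ := hn
      exact ⟨⟨(z, n), i, y, hy, hn⟩, hz, fun h => (Nat.succ_ne_zero n h).elim,
        fun _ => Nat.lt_succ_self n⟩
  choose f hf₁ hf₂ hf₃ using step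
  let v : ℕ → V := fun i => f^[i] ⟨(x, 0), 0, x, hx, rfl⟩
  have hv : ∀ i, v (i + 1) = f (v i) := fun i => Function.iterate_succ_apply' f i _
  refine ⟨fun i => (v i).1.1, rfl, fun i => ?_, fun N => ?_⟩
  · beta_reduce
    rw [hv]
    exact hf₁ _
  · have : ∀ n N, (v N).1.2 = n → ∃ i ≥ N, P (v i).1.1 := by
      intro n
      induction n using Nat.strong_induction_on with
      | _ n ih =>
        intro N hN
        by_cases hn : (v N).1.2 = 0
        · exact ⟨N, le_rfl, hf₂ _ hn⟩
        · have := hf₃ _ hn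
          rw [← hv, hN] at this
          obtain ⟨i, hi, hP⟩ := ih _ this (N + 1) rfl
          exact ⟨i, by omega, hP⟩
    exact this _ N rfl

theorem exists_chain_of_transGen {α : Type} {r : α → α → Prop} {a : ℕ → α}
    (h : ∀ i, Relation.TransGen r (a i) (a (i + 1))) :
    ∃ c : ℕ → α, c 0 = a 0 ∧ ∀ i, r (c i) (c (i + 1)) := by
  obtain ⟨c, h₀, h₁, -⟩ := exists_recurring_chain (P := fun _ => True) (fun i x => x = a i)
    (by rintro i _ rfl; exact ⟨trivial, _, rfl, h i⟩) (x := a 0) rfl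
  exact ⟨c, h₀, h₁⟩

/-! ### Counter machines -/

/-- An instruction list of a counter machine: `(q, o, q')` goes from `q` to `q'` performing `o`. -/
abbrev Instrs : Type := List (ℕ × Op × ℕ)

/-- The step relation of a counter machine. -/
def Instrs.Step (I : Instrs) (x y : ℕ × Store) : Prop :=
  ∃ o, (x.1, o, y.1) ∈ I ∧ o.Rel x.2 y.2

namespace Prog

/-- The continuations reachable in one step from a list of programs to be executed. -/
def succs : List Prog → List (Op × List Prog)
  | [] => []
  | atom o :: K => [(o, K)]
  | seq p q :: K => [(.nop, p :: q :: K)]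
  | alt p q :: K => [(.nop, p :: K), (.nop, q :: K)]
  | star p :: K => [(.nop, K), (.nop, p :: star p :: K)]

/-- All continuations met while executing a program before the continuation `K`. -/
def conts : Prog → List Prog → List (List Prog)
  | atom o, K => [atom o :: K]
  | seq p q, K => (seq p q :: K) :: (conts p (q :: K) ++ conts q K)
  | alt p q, K => (alt p q :: K) :: (conts p K ++ conts q K)
  | star p, K => (star p :: K) :: conts p (star p :: K)

theorem self_mem_conts (p : Prog) (K : List Prog) : p :: K ∈ conts p K := by
  cases p <;> simp [conts]

theorem mem_conts_of_mem_succs {p : Prog} {K C : List Prog} (hC : C ∈ conts p K)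
    {e : Op × List Prog} (he : e ∈ succs C) : e.2 ∈ conts p K ∨ e.2 = K := by
  induction p generalizing K with
  | atom o =>
    simp only [conts, List.mem_singleton] at hC
    subst hC
    simp only [succs, List.mem_singleton] at he
    simp [he]
  | seq p q ihp ihq =>
    simp only [conts, List.mem_cons, List.mem_append] at hC ⊢
    rcases hC with rfl | hC | hC
    · simp only [succs, List.mem_singleton] at he
      simp [he, self_mem_conts]
    · rcases ihp hC with h | h
      · simp [h]
      · simp [h, self_mem_conts]
    · rcases ihq hC with h | h <;> simp [h]
  | alt p q ihp ihq =>
    simp only [conts, List.mem_cons, List.mem_append] at hC ⊢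
    rcases hC with rfl | hC | hC
    · simp only [succs, List.mem_cons, List.not_mem_nil, or_false] at he
      rcases he with rfl | rfl <;> simp [self_mem_conts]
    · rcases ihp hC with h | h <;> simp [h]
    · rcases ihq hC with h | h <;> simp [h]
  | star p ih =>
    simp only [conts, List.mem_cons] at hC ⊢
    rcases hC with rfl | hC
    · simp only [succs, List.mem_cons, List.not_mem_nil, or_false] at he
      rcases he with rfl | rfl <;> simp [self_mem_conts]
    · rcases ih hC with h | h <;> simp [h]

/-- The input-output relation of a list of programs. -/
def RelList : List Prog → Store → Store → Prop
  | [] => Eq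
  | p :: K => Relation.Comp p.Rel (RelList K)

theorem RelList.of_mem_succs {C : List Prog} {e : Op × List Prog} (he : e ∈ succs C)
    {s s' t : Store} (h : e.1.Rel s s') (ht : RelList e.2 s' t) : RelList C s t := by
  match C with
  | [] => simp [succs] at he
  | atom o :: K =>
    simp only [succs, List.mem_singleton] at he
    subst he
    exact ⟨s', h, ht⟩
  | seq p q :: K =>
    simp only [succs, List.mem_singleton] at he
    subst he
    obtain rfl : s' = s := h
    obtain ⟨u, hu, v, hv, h⟩ := ht
    exact ⟨v, ⟨u, hu, hv⟩, h⟩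
  | alt p q :: K =>
    simp only [succs, List.mem_cons, List.not_mem_nil, or_false] at he
    rcases he with rfl | rfl <;> obtain rfl : s' = s := h <;> obtain ⟨u, hu, h⟩ := ht
    · exact ⟨u, .inl hu, h⟩
    · exact ⟨u, .inr hu, h⟩
  | star p :: K =>
    simp only [succs, List.mem_cons, List.not_mem_nil, or_false] at he
    rcases he with rfl | rfl <;> obtain rfl : s' = s := h
    · exact ⟨s', .refl, ht⟩
    · obtain ⟨u, hu, v, hv, h⟩ := ht
      exact ⟨v, .head hu hv, h⟩

/-- One step of execution of a list of programs. -/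
def Step (x y : List Prog × Store) : Prop := ∃ o, (o, y.1) ∈ succs x.1 ∧ o.Rel x.2 y.2

theorem Rel.reflTransGen {p : Prog} {s t : Store} (h : p.Rel s t) (K : List Prog) :
    Relation.ReflTransGen Step (p :: K, s) (K, t) := by
  induction p generalizing K s t with
  | atom o => exact .single ⟨o, by simp [succs], h⟩
  | seq p q ihp ihq =>
    obtain ⟨u, h₁, h₂⟩ := h
    exact .head (b := (p :: q :: K, s)) ⟨.nop, by simp [succs], rfl⟩ ((ihp h₁ _).trans (ihq h₂ _))
  | alt p q ihp ihq =>
    rcases h with h | h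
    · exact .head (b := (p :: K, s)) ⟨.nop, by simp [succs], rfl⟩ (ihp h _)
    · exact .head (b := (q :: K, s)) ⟨.nop, by simp [succs], rfl⟩ (ihq h _)
  | star p ih =>
    have : Relation.ReflTransGen p.Rel s t := h
    clear h
    induction this using Relation.ReflTransGen.head_induction_on with
    | refl => exact .single ⟨.nop, by simp [succs], rfl⟩
    | @head s u h _ ih' =>
      exact .head (b := (p :: star p :: K, s)) ⟨.nop, by simp [succs], rfl⟩ ((ih h _).trans ih')

/-- The states of the counter machine executing a program: `[]` is the final one. -/
def states (p : Prog) : List (List Prog) := [] :: conts p []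

open scoped Classical in
/-- The number of a state. -/
noncomputable def code (p : Prog) (C : List Prog) : ℕ := p.states.idxOf C

theorem code_nil (p : Prog) : p.code [] = 0 := by simp [code, states]

open scoped Classical in
theorem code_lt {p : Prog} {C : List Prog} (h : C ∈ p.states) : p.code C < p.states.length :=
  List.idxOf_lt_length_of_mem h

open scoped Classical in
theorem code_inj {p : Prog} {C D : List Prog} (h : C ∈ p.states) (e : p.code C = p.code D) :
    C = D :=
  (List.idxOf_inj h).1 e

theorem mem_states_of_mem_succs {p : Prog} {C : List Prog} (hC : C ∈ p.states)
    {e : Op × List Prog} (he : e ∈ succs C) : e.2 ∈ p.states := by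
  rcases List.mem_cons.1 hC with rfl | hC
  · simp [succs] at he
  · rcases mem_conts_of_mem_succs hC he with h | h <;> simp [states, h]

/-- The instructions executing a program. -/
noncomputable def instrs (p : Prog) : Instrs :=
  p.states.flatMap fun C => (succs C).map fun e => (p.code C, e.1, p.code e.2)

theorem mem_instrs {p : Prog} {q q' : ℕ} {o : Op} : (q, o, q') ∈ p.instrs ↔
    ∃ C ∈ p.states, ∃ e ∈ succs C, q = p.code C ∧ o = e.1 ∧ q' = p.code e.2 := by
  simp [instrs, eq_comm]

/-- A counter machine which repeatedly adds `a` to counter `1` and then executes `p`. -/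
noncomputable def loop (p : Prog) (a : ℕ) : Instrs :=
  p.instrs ++ ((0, .nop, p.states.length) ::
    ((List.range a).map fun j => (p.states.length + j, .inc 1, p.states.length + j + 1)) ++
    [(p.states.length + a, .nop, p.code [p])])

theorem mem_loop {p : Prog} {a q q' : ℕ} {o : Op} : (q, o, q') ∈ p.loop a ↔
    (q, o, q') ∈ p.instrs ∨ (q = 0 ∧ o = .nop ∧ q' = p.states.length) ∨
    (∃ j < a, q = p.states.length + j ∧ o = .inc 1 ∧ q' = p.states.length + j + 1) ∨
    (q = p.states.length + a ∧ o = .nop ∧ q' = p.code [p]) := by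
  simp [loop, eq_comm]

/-- The effect of one iteration of `loop`. -/
def LoopRel (p : Prog) (a : ℕ) (s s' : Store) : Prop :=
  p.Rel (Function.update s 1 (s 1 + a)) s'

theorem singleton_mem_states (p : Prog) : [p] ∈ p.states :=
  List.mem_cons_of_mem _ (self_mem_conts p [])

theorem LoopRel.transGen {p : Prog} {a : ℕ} {s s' : Store} (h : p.LoopRel a s s') :
    Relation.TransGen (p.loop a).Step (0, s) (0, s') := by
  have up : ∀ j ≤ a, Relation.ReflTransGen (p.loop a).Step (p.states.length, s)
      (p.states.length + j, Function.update s 1 (s 1 + j)) := by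
    intro j
    induction j with
    | zero => intro _; simpa using Relation.ReflTransGen.refl
    | succ j ih =>
      intro hj
      refine .tail (ih (by omega))
        ⟨.inc 1, mem_loop.2 (.inr (.inr (.inl ⟨j, hj, rfl, rfl, rfl⟩))), ?_⟩
      simp [Op.Rel, add_assoc]
  have run : ∀ x y, Relation.ReflTransGen Step x y → x.1 ∈ p.states →
      y.1 ∈ p.states ∧ Relation.ReflTransGen (p.loop a).Step (p.code x.1, x.2)
        (p.code y.1, y.2) := by
    intro x y h hx
    induction h with
    | refl => exact ⟨hx, .refl⟩
    | tail _ h ih =>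
      obtain ⟨o, ho, h⟩ := h
      refine ⟨mem_states_of_mem_succs ih.1 ho, .tail ih.2 ⟨o, mem_loop.2 (.inl ?_), h⟩⟩
      exact mem_instrs.2 ⟨_, ih.1, _, ho, rfl, rfl, rfl⟩
  have := (run _ _ (Rel.reflTransGen h []) p.singleton_mem_states).2
  rw [code_nil] at this
  refine .head' (b := (p.states.length, s))
    ⟨.nop, mem_loop.2 (.inr (.inl ⟨rfl, rfl, rfl⟩)), rfl⟩ ((up a le_rfl).trans (.head ?_ this))
  exact ⟨.nop, mem_loop.2 (.inr (.inr (.inr ⟨rfl, rfl, rfl⟩))), rfl⟩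

theorem LoopRel.of_transGen {p : Prog} {a : ℕ} {s t : Store}
    (h : Relation.TransGen (p.loop a).Step (0, s) (0, t)) :
    Relation.TransGen (p.LoopRel a) s t := by
  let Fin : ℕ → Store → Store → Prop := fun q s u =>
    (∃ C ∈ p.states, q = p.code C ∧ RelList C s u) ∨
    ∃ j ≤ a, q = p.states.length + j ∧ p.Rel (Function.update s 1 (s 1 + (a - j))) u
  have fin_length : ∀ s u, Fin p.states.length s u → p.LoopRel a s u := by
    rintro s u (⟨C, hC, e, -⟩ | ⟨j, hj, e, h⟩)
    · have := code_lt hC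
      omega
    · obtain rfl : j = 0 := by omega
      exact h
  have key : ∀ x : ℕ × Store, Relation.ReflTransGen (p.loop a).Step x (0, t) →
      ∃ u, Fin x.1 x.2 u ∧ Relation.ReflTransGen (p.LoopRel a) u t := by
    intro x h
    induction h using Relation.ReflTransGen.head_induction_on with
    | refl => exact ⟨t, .inl ⟨[], by simp [states], (code_nil p).symm, rfl⟩, .refl⟩
    | @head x y h _ ih =>
      obtain ⟨q, s⟩ := x
      obtain ⟨q', s'⟩ := y
      obtain ⟨o, ho, h⟩ := h
      obtain ⟨u, hu, hut⟩ := ih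
      simp only at ho h hu
      rcases mem_loop.1 ho with ho | ⟨rfl, rfl, rfl⟩ | ⟨j, hj, rfl, rfl, rfl⟩ | ⟨rfl, rfl, rfl⟩
      · obtain ⟨C, hC, e, he, rfl, rfl, rfl⟩ := mem_instrs.1 ho
        have he' := mem_states_of_mem_succs hC he
        refine ⟨u, .inl ⟨C, hC, rfl, ?_⟩, hut⟩
        rcases hu with ⟨D, hD, e', hu⟩ | ⟨j, hj, e', -⟩
        · obtain rfl := code_inj he' e'
          exact RelList.of_mem_succs he h hu
        · have := code_lt he'
          omega
      · obtain rfl : s' = s := h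
        exact ⟨s', .inl ⟨[], by simp [states], (code_nil p).symm, rfl⟩,
          .head (fin_length _ _ hu) hut⟩
      · refine ⟨u, .inr ⟨j, hj.le, rfl, ?_⟩, hut⟩
        rcases hu with ⟨D, hD, e', -⟩ | ⟨i, hi, e', hu⟩
        · have := code_lt hD
          omega
        · obtain rfl : i = j + 1 := by omega
          obtain rfl : s' = _ := h
          simpa [add_assoc, show 1 + (a - (j + 1)) = a - j by omega] using hu
      · obtain rfl : s' = s := h
        refine ⟨u, .inr ⟨a, le_rfl, rfl, ?_⟩, hut⟩
        rcases hu with ⟨D, hD, e', hu⟩ | ⟨i, hi, e', hu⟩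
        · obtain rfl := code_inj p.singleton_mem_states e'
          obtain ⟨u', hu, rfl⟩ := hu
          simpa using hu
        · have := code_lt p.singleton_mem_states
          omega
  obtain ⟨⟨q', s'⟩, ⟨o, ho, h⟩, h'⟩ := Relation.TransGen.head'_iff.1 h
  have hpos : 0 < p.states.length := by simp [states]
  rcases mem_loop.1 ho with ho | ⟨-, rfl, e⟩ | ⟨j, hj, e, -⟩ | ⟨e, -⟩
  · obtain ⟨C, hC, e, he, h, -⟩ := mem_instrs.1 ho
    obtain rfl : [] = C := code_inj (by simp [states]) ((code_nil p).trans h)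
    simp [succs] at he
  · obtain ⟨u, hu, hut⟩ := key _ h'
    simp only at e
    obtain rfl : s' = s := h
    simp only [e] at hu
    exact .head' (fin_length _ _ hu) hut
  · omega
  · omega

end Prog

/-! ### Simulating counter machines by Turing machines -/

/-- All counters used by an instruction are below `k`. -/
def Op.Below (k : ℕ) : Op → Prop
  | nop => True
  | inc i => i < k
  | dec i => i < k
  | zero i => i < k

namespace Simul

/-- The number of machine states per counter machine state. -/
def width (k : ℕ) : ℕ := 3 * k + 2

/-- The index of an instruction among those using counters below `k`. -/
def opIndex : Op → ℕ
  | .nop => 1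
  | .inc i => 3 * i + 2
  | .dec i => 3 * i + 3
  | .zero i => 3 * i + 4

/-- The state walking left to the marker, in order to continue in state `q`. -/
def stL (k q : ℕ) : ℕ := width k * q

/-- The state walking right to perform `o`, in order to continue in state `q`. -/
def stR (k : ℕ) (o : Op) (q : ℕ) : ℕ := width k * q + opIndex o

/-- The symbol at which the walk to the right may turn. -/
def turnIn (k : ℕ) : Op → ℕ
  | .dec i => 2 + i
  | _ => k + 2

/-- The symbol written when turning. -/
def turnOut : Op → ℕ
  | .inc i => 2 + i
  | _ => 0

/-- The symbols which may not be skipped when walking to the right. -/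
def barrier : Op → ℕ
  | .zero i => 2 + i
  | _ => 1

/-- The transitions simulating one instruction. -/
def entries (k : ℕ) (o : Op) (q q' : ℕ) : List ((ℕ × ℕ) × (ℕ × ℕ × Bool)) :=
  (((List.range (k + 2)).filter (· ≠ 1)).map fun c => ((stL k q', c), (stL k q', c, false))) ++
  (((List.range (k + 2)).filter (· ≠ 1)).filter (· ≠ barrier o)).map
    (fun c => ((stR k o q', c), (stR k o q', c, true))) ++
  [((stL k q, 1), (stR k o q', 1, true)),
    ((stR k o q', turnIn k o), (stL k q', turnOut o, false))]

/-- The Turing machine simulating a counter machine with `n` states and `k` counters. -/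
def machine (k n : ℕ) (I : Instrs) : NTM :=
  (width k * n, k + 2, I.flatMap fun e => entries k e.2.1 e.1 e.2.2)

variable {k : ℕ}

theorem opIndex_lt {o : Op} (h : o.Below k) : opIndex o < width k := by
  cases o <;> simp only [Op.Below, opIndex, width] at * <;> omega

theorem opIndex_pos (o : Op) : 0 < opIndex o := by
  cases o <;> simp [opIndex]

theorem opIndex_inj {o o' : Op} (h : opIndex o = opIndex o') : o = o' := by
  cases o <;> cases o' <;> simp only [opIndex] at h <;> first | rfl | (congr 1; omega)

theorem width_mul_add_inj {q q' i i' : ℕ} (hi : i < width k) (hi' : i' < width k)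
    (h : width k * q + i = width k * q' + i') : q = q' ∧ i = i' := by
  have h₁ := congrArg (· / width k) h
  have h₂ := congrArg (· % width k) h
  have : 0 < width k := by omega
  simpa [Nat.mul_add_div this, Nat.mul_add_mod, Nat.mod_eq_of_lt, Nat.div_eq_of_lt, hi, hi']
    using And.intro h₁ h₂

theorem width_pos : 0 < width k := by simp [width]

theorem stL_inj {q q' : ℕ} (h : stL k q = stL k q') : q = q' :=
  (width_mul_add_inj width_pos width_pos h).1

theorem stR_inj {o o' : Op} {q q' : ℕ} (ho : o.Below k) (ho' : o'.Below k)
    (h : stR k o q = stR k o' q') : o = o' ∧ q = q' := by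
  obtain ⟨h₁, h₂⟩ := width_mul_add_inj (opIndex_lt ho) (opIndex_lt ho') h
  exact ⟨opIndex_inj h₂, h₁⟩

theorem stL_ne_stR {o : Op} {q q' : ℕ} (ho : o.Below k) : stL k q ≠ stR k o q' := fun h => by
  have := (width_mul_add_inj width_pos (opIndex_lt ho) h).2
  have := opIndex_pos o
  omega

theorem mem_entries {o : Op} {q q' s c s' b : ℕ} {d : Bool} :
    ((s, c), (s', b, d)) ∈ entries k o q q' ↔
      (c < k + 2 ∧ c ≠ 1 ∧ s = stL k q' ∧ s' = stL k q' ∧ b = c ∧ d = false) ∨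
      (c < k + 2 ∧ c ≠ 1 ∧ c ≠ barrier o ∧ s = stR k o q' ∧ s' = stR k o q' ∧ b = c ∧ d = true) ∨
      (c = 1 ∧ s = stL k q ∧ s' = stR k o q' ∧ b = 1 ∧ d = true) ∨
      (c = turnIn k o ∧ s = stR k o q' ∧ s' = stL k q' ∧ b = turnOut o ∧ d = false) := by
  simp only [entries, List.mem_append, List.mem_map, List.mem_filter, List.mem_range, List.mem_cons,
    List.not_mem_nil, or_false, Prod.mk.injEq, decide_eq_true_eq]
  constructor
  · rintro ((⟨c, ⟨h₁, h₂⟩, ⟨rfl, rfl⟩, rfl, rfl, rfl⟩ |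
        ⟨c, ⟨⟨h₁, h₂⟩, h₃⟩, ⟨rfl, rfl⟩, rfl, rfl, rfl⟩) |
      ⟨⟨rfl, rfl⟩, h⟩ | ⟨⟨rfl, rfl⟩, h⟩)
    · exact .inl ⟨h₁, h₂, rfl, rfl, rfl, rfl⟩
    · exact .inr (.inl ⟨h₁, h₂, h₃, rfl, rfl, rfl, rfl⟩)
    · exact .inr (.inr (.inl ⟨rfl, rfl, h⟩))
    · exact .inr (.inr (.inr ⟨rfl, rfl, h⟩))
  · rintro (⟨h₁, h₂, rfl, rfl, rfl, rfl⟩ | ⟨h₁, h₂, h₃, rfl, rfl, rfl, rfl⟩ | ⟨rfl, rfl, h⟩ |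
      ⟨rfl, rfl, h⟩)
    · exact .inl (.inl ⟨_, ⟨h₁, h₂⟩, ⟨rfl, rfl⟩, rfl, rfl, rfl⟩)
    · exact .inl (.inr ⟨_, ⟨⟨h₁, h₂⟩, h₃⟩, ⟨rfl, rfl⟩, rfl, rfl, rfl⟩)
    · exact .inr (.inl ⟨⟨rfl, rfl⟩, h⟩)
    · exact .inr (.inr ⟨⟨rfl, rfl⟩, h⟩)

variable {n : ℕ} {I : Instrs}

theorem mem_table {e : (ℕ × ℕ) × (ℕ × ℕ × Bool)} :
    e ∈ (machine k n I).table ↔ ∃ q o q', (q, o, q') ∈ I ∧ e ∈ entries k o q q' := by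
  simp [machine, NTM.table]

theorem turnOut_lt {o : Op} (h : o.Below k) : turnOut o < k + 2 := by
  cases o <;> simp only [turnOut, Op.Below] at * <;> omega

theorem turnIn_le {o : Op} (h : o.Below k) : turnIn k o ≤ k + 2 := by
  cases o <;> simp only [turnIn, Op.Below] at * <;> omega

/-- The numbers of states and counters used by the instructions are bounded by `n` and `k`. -/
def Bounded (k n : ℕ) (I : Instrs) : Prop :=
  ∀ q o q', (q, o, q') ∈ I → q < n ∧ q' < n ∧ o.Below k

theorem machine_wf (hn : 0 < n) (h : Bounded k n I) : (machine k n I).WF := by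
  refine ⟨Nat.mul_pos width_pos hn, by simp [machine, NTM.blank], ?_⟩
  rintro ⟨⟨s, c⟩, s', b, d⟩ he
  obtain ⟨q, o, q', hI, he⟩ := mem_table.1 he
  obtain ⟨hq, hq', ho⟩ := h q o q' hI
  have hL : ∀ q < n, stL k q < width k * n := fun q hq => Nat.mul_lt_mul_of_pos_left hq width_pos
  have hR : stR k o q' < width k * n := by
    have h₁ := Nat.mul_le_mul_left (width k) (Nat.succ_le_of_lt hq')
    have h₂ := opIndex_lt ho
    rw [Nat.mul_succ] at h₁
    exact (Nat.add_lt_add_left h₂ _).trans_le h₁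
  have h₁ := hL q hq
  have h₂ := hL q' hq'
  have h₃ := turnOut_lt ho
  have h₄ := turnIn_le ho
  simp only [machine, NTM.numStates, NTM.blank]
  rcases mem_entries.1 he with h | h | h | h <;> grind

theorem mem_table_stL {q c s' b : ℕ} {d : Bool} (h : Bounded k n I)
    (he : ((stL k q, c), (s', b, d)) ∈ (machine k n I).table) :
    (c < k + 2 ∧ c ≠ 1 ∧ s' = stL k q ∧ b = c ∧ d = false) ∨
    (c = 1 ∧ ∃ o q', (q, o, q') ∈ I ∧ s' = stR k o q' ∧ b = 1 ∧ d = true) := by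
  obtain ⟨q₁, o, q', hI, he⟩ := mem_table.1 he
  have ho := (h _ _ _ hI).2.2
  rcases mem_entries.1 he with ⟨h₁, h₂, h₃, h₄⟩ | h | ⟨h₁, h₂, h₃⟩ | h
  · rw [← h₃] at h₄
    exact .inl ⟨h₁, h₂, h₄⟩
  · exact (stL_ne_stR ho h.2.2.2.1).elim
  · obtain rfl := stL_inj h₂
    exact .inr ⟨h₁, o, q', hI, h₃⟩
  · exact (stL_ne_stR ho h.2.1).elim

theorem mem_table_stR {o : Op} {q c s' b : ℕ} {d : Bool} (h : Bounded k n I) (ho : o.Below k)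
    (he : ((stR k o q, c), (s', b, d)) ∈ (machine k n I).table) :
    (c < k + 2 ∧ c ≠ 1 ∧ c ≠ barrier o ∧ s' = stR k o q ∧ b = c ∧ d = true) ∨
    (c = turnIn k o ∧ s' = stL k q ∧ b = turnOut o ∧ d = false) := by
  obtain ⟨q₁, o', q', hI, he⟩ := mem_table.1 he
  have ho' := (h _ _ _ hI).2.2
  rcases mem_entries.1 he with h | ⟨h₁, h₂, h₃, h₄, h₅⟩ | h | ⟨h₁, h₂, h₃⟩
  · exact (stL_ne_stR ho h.2.2.1.symm).elim
  · obtain ⟨rfl, rfl⟩ := stR_inj ho ho' h₄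
    exact .inl ⟨h₁, h₂, h₃, h₅⟩
  · exact (stL_ne_stR ho h.2.1.symm).elim
  · obtain ⟨rfl, rfl⟩ := stR_inj ho ho' h₂
    exact .inr ⟨h₁, h₃⟩

theorem eq_stL_or_stR {s c s' b : ℕ} {d : Bool} (h : Bounded k n I)
    (he : ((s, c), (s', b, d)) ∈ (machine k n I).table) :
    (∃ q, s = stL k q) ∨ ∃ o q, o.Below k ∧ s = stR k o q := by
  obtain ⟨q, o, q', hI, he⟩ := mem_table.1 he
  have ho := (h _ _ _ hI).2.2
  rcases mem_entries.1 he with h | h | h | h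
  · exact .inl ⟨_, h.2.2.1⟩
  · exact .inr ⟨_, _, ho, h.2.2.2.1⟩
  · exact .inl ⟨_, h.2.1⟩
  · exact .inr ⟨_, _, ho, h.2.1⟩

/-! #### Tapes split at the head -/

/-- In the configuration `ρ` with state `s`, the tape contains `x` left of the head and `y`,
followed by blanks, from the head on. -/
def Split (k s : ℕ) (x y : List ℕ) (ρ : Config) : Prop :=
  ∃ m, ρ = (x ++ y ++ List.replicate (m + 1) (k + 2), x.length, s)

theorem Split.getD {s : ℕ} {x y : List ℕ} {ρ : Config} (h : Split k s x y ρ) :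
    ρ.1.getD ρ.2.1 0 = y.headD (k + 2) := by
  obtain ⟨m, rfl⟩ := h
  cases y <;> simp [List.getD_eq_getElem?_getD, List.replicate_succ]

theorem Split.set {s : ℕ} {x y : List ℕ} {ρ : Config} (h : Split k s x y ρ) (b : ℕ) :
    ∃ m, ρ.1.set ρ.2.1 b ++ [k + 2] = x ++ b :: y.tail ++ List.replicate (m + 1) (k + 2) := by
  obtain ⟨m, rfl⟩ := h
  cases y with
  | nil =>
    refine ⟨m, ?_⟩
    simp [List.replicate_succ, ← List.replicate_succ']
  | cons c y =>
    refine ⟨m + 1, ?_⟩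
    rw [List.replicate_succ' (n := m + 1)]
    simp

variable {s : ℕ} {x y : List ℕ} {ρ ρ' : Config}

theorem Split.next (h : Split k s x y ρ) (hn : (machine k n I).Next ρ ρ') :
    ∃ s' b d, ((s, y.headD (k + 2)), (s', b, d)) ∈ (machine k n I).table ∧
      ((d = true ∧ Split k s' (x ++ [b]) y.tail ρ') ∨
        (d = false ∧ ∃ x' c, x = x' ++ [c] ∧ Split k s' x' (c :: b :: y.tail) ρ')) := by
  obtain ⟨s', b, d, he, hd, rfl⟩ := hn
  have hg := h.getD
  obtain ⟨m, hm⟩ := h.set b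
  obtain ⟨m', rfl⟩ := h
  simp only at hg hm he hd
  rw [hg] at he
  refine ⟨s', b, d, he, ?_⟩
  cases d with
  | true =>
    refine .inl ⟨rfl, m, ?_⟩
    simp only [show (machine k n I).blank = k + 2 from rfl, hm]
    simp
  | false =>
    rcases List.eq_nil_or_concat' x with rfl | ⟨x', c, rfl⟩
    · simp at hd
    · refine .inr ⟨rfl, x', c, rfl, m, ?_⟩
      simp only [show (machine k n I).blank = k + 2 from rfl, hm]
      simp

theorem Split.right (h : Split k s x y ρ) {s' b : ℕ}
    (he : ((s, y.headD (k + 2)), (s', b, true)) ∈ (machine k n I).table) :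
    ∃ ρ', (machine k n I).Next ρ ρ' ∧ Split k s' (x ++ [b]) y.tail ρ' := by
  obtain ⟨m, hm⟩ := h.set b
  refine ⟨_, ⟨s', b, true, ?_, .inl rfl, rfl⟩, m, ?_⟩
  · rw [h.getD]
    obtain ⟨m', rfl⟩ := h
    exact he
  · simp only [show (machine k n I).blank = k + 2 from rfl, hm]
    obtain ⟨m', rfl⟩ := h
    simp

theorem Split.left {c : ℕ} (h : Split k s (x ++ [c]) y ρ) {s' b : ℕ}
    (he : ((s, y.headD (k + 2)), (s', b, false)) ∈ (machine k n I).table) :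
    ∃ ρ', (machine k n I).Next ρ ρ' ∧ Split k s' x (c :: b :: y.tail) ρ' := by
  obtain ⟨m, hm⟩ := h.set b
  refine ⟨_, ⟨s', b, false, ?_, .inr ?_, rfl⟩, m, ?_⟩
  · rw [h.getD]
    obtain ⟨m', rfl⟩ := h
    exact he
  · obtain ⟨m', rfl⟩ := h
    simp
  · simp only [show (machine k n I).blank = k + 2 from rfl, hm]
    obtain ⟨m', rfl⟩ := h
    simp

variable {k n : ℕ} {I : Instrs}

/-- The store represented by the tape contents right of the marker. -/
def store (w : List ℕ) : Store := fun i => w.count (2 + i)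

theorem store_append (u v : List ℕ) (i : ℕ) : store (u ++ v) i = store u i + store v i :=
  List.count_append

theorem store_cons_zero (v : List ℕ) : store (0 :: v) = store v := by
  funext i
  exact List.count_cons_of_ne (by omega)

theorem store_cons_token (v : List ℕ) (j : ℕ) :
    store ((2 + j) :: v) = Function.update (store v) j (store v j + 1) := by
  funext i
  by_cases h : i = j
  · subst h
    simp [store]
  · rw [Function.update_of_ne h]
    exact List.count_cons_of_ne (by omega)

theorem store_insert_zero (u v : List ℕ) : store (u ++ 0 :: v) = store (u ++ v) := by
  funext i
  rw [store_append, store_append, store_cons_zero]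

theorem store_insert_token (u v : List ℕ) (j : ℕ) :
    store (u ++ (2 + j) :: v) = Function.update (store (u ++ v)) j (store (u ++ v) j + 1) := by
  funext i
  rw [store_append, store_cons_token]
  by_cases h : i = j
  · subst h
    simp [store_append, add_assoc]
  · simp [Function.update_of_ne h, store_append]

/-- Proper symbols other than the marker. -/
def Plain (k a : ℕ) : Prop := a < k + 2 ∧ a ≠ 1

/-! #### The Turing machine simulates the counter machine -/

theorem sweep_left {q₀ q : ℕ} {o : Op} (hI : (q₀, o, q) ∈ I) (u : List ℕ) :
    ∀ (x v : List ℕ) (c : ℕ) (ρ : Config), (∀ a ∈ u, Plain k a) → x ++ [c] = 1 :: u →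
      Split k (stL k q) x (c :: v) ρ → ∃ ρ', Relation.ReflTransGen (machine k n I).Next ρ ρ' ∧
        Split k (stL k q) [] (1 :: (u ++ v)) ρ' := by
  induction u using List.reverseRecOn with
  | nil =>
    intro x v c ρ _ hx h
    obtain ⟨rfl, rfl⟩ : x = [] ∧ c = 1 := by
      cases x <;> simp_all
    exact ⟨ρ, .refl, h⟩
  | append_singleton u a ih =>
    intro x v c ρ hu hx h
    rw [← List.cons_append, List.append_singleton_inj] at hx
    obtain ⟨rfl, rfl⟩ := hx
    obtain ⟨x, b, hx⟩ : ∃ x b, 1 :: u = x ++ [b] := by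
      rcases List.eq_nil_or_concat' (1 :: u) with h | ⟨x, b, h⟩
      · simp at h
      · exact ⟨x, b, h⟩
    rw [hx] at h
    obtain ⟨h₁, h₂⟩ := hu c (by simp)
    obtain ⟨ρ₁, hn, h⟩ := h.left (n := n) (I := I) (s' := stL k q) (b := c)
      (mem_table.2 ⟨_, _, _, hI, mem_entries.2 (.inl ⟨h₁, h₂, rfl, rfl, rfl, rfl⟩)⟩)
    obtain ⟨ρ₂, hr, h⟩ := ih x (c :: v) b ρ₁ (fun a ha => hu a (by simp [ha])) hx.symm h
    exact ⟨ρ₂, .head hn hr, by simpa using h⟩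

theorem sweep_right {q₀ q : ℕ} {o : Op} (hI : (q₀, o, q) ∈ I) (u : List ℕ) :
    ∀ (x v : List ℕ) (ρ : Config), (∀ a ∈ u, Plain k a ∧ a ≠ barrier o) →
      Split k (stR k o q) x (u ++ v) ρ → ∃ ρ', Relation.ReflTransGen (machine k n I).Next ρ ρ' ∧
        Split k (stR k o q) (x ++ u) v ρ' := by
  induction u with
  | nil =>
    intro x v ρ _ h
    exact ⟨ρ, .refl, by simpa using h⟩
  | cons a u ih =>
    intro x v ρ hu h
    obtain ⟨⟨h₁, h₂⟩, h₃⟩ := hu a (by simp)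
    obtain ⟨ρ₁, hn, h⟩ := h.right (n := n) (I := I) (s' := stR k o q) (b := a)
      (mem_table.2 ⟨_, _, _, hI, mem_entries.2 (.inr (.inl ⟨h₁, h₂, h₃, rfl, rfl, rfl, rfl⟩))⟩)
    obtain ⟨ρ₂, hr, h⟩ := ih (x ++ [a]) v ρ₁ (fun b hb => hu b (by simp [hb])) h
    exact ⟨ρ₂, .head hn hr, by simpa using h⟩

theorem roundtrip {q q' : ℕ} {o : Op} (hI : (q, o, q') ∈ I) {u v : List ℕ}
    (hu : ∀ a ∈ u, Plain k a ∧ a ≠ barrier o) (hv : v.headD (k + 2) = turnIn k o) {ρ : Config}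
    (h : Split k (stL k q) [] (1 :: (u ++ v)) ρ) :
    ∃ ρ', Relation.TransGen (machine k n I).Next ρ ρ' ∧
      Split k (stL k q') [] (1 :: (u ++ turnOut o :: v.tail)) ρ' := by
  obtain ⟨ρ₁, hn, h⟩ := h.right (n := n) (I := I) (s' := stR k o q') (b := 1)
    (mem_table.2 ⟨_, _, _, hI, mem_entries.2 (.inr (.inr (.inl ⟨rfl, rfl, rfl, rfl, rfl⟩)))⟩)
  obtain ⟨ρ₂, hr, h⟩ := sweep_right (n := n) hI u _ v ρ₁ hu h
  obtain ⟨x, b, hx⟩ : ∃ x b, 1 :: u = x ++ [b] := by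
    rcases List.eq_nil_or_concat' (1 :: u) with h | ⟨x, b, h⟩
    · simp at h
    · exact ⟨x, b, h⟩
  simp only [List.nil_append, List.cons_append, hx] at h
  obtain ⟨ρ₃, hn', h⟩ := h.left (n := n) (I := I) (s' := stL k q') (b := turnOut o)
    (mem_table.2 ⟨_, _, _, hI, mem_entries.2 (.inr (.inr (.inr ⟨hv, rfl, rfl, rfl, rfl⟩)))⟩)
  obtain ⟨ρ₄, hr', h⟩ := sweep_left (n := n) hI u x _ b ρ₃ (fun a ha => (hu a ha).1) hx.symm h
  exact ⟨ρ₄, (Relation.TransGen.head' hn hr).trans (.head' hn' hr'), h⟩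

theorem simulate_step {q q' : ℕ} {o : Op} (hI : (q, o, q') ∈ I) (ho : o.Below k) {w : List ℕ}
    {s : Store} (hs : o.Rel (store w) s) (hw : ∀ a ∈ w, Plain k a) {ρ : Config}
    (h : Split k (stL k q) [] (1 :: w) ρ) :
    ∃ w' ρ', store w' = s ∧ (∀ a ∈ w', Plain k a) ∧ Relation.TransGen (machine k n I).Next ρ ρ' ∧
      Split k (stL k q') [] (1 :: w') ρ' := by
  have plain : ∀ u v, (∀ a ∈ u ++ v, Plain k a) → ∀ a ∈ u ++ turnOut o :: v.tail, Plain k a := by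
    intro u v huv a ha
    rcases List.mem_append.1 ha with ha | ha
    · exact huv a (by simp [ha])
    rcases List.mem_cons.1 ha with rfl | ha
    · refine ⟨turnOut_lt ho, ?_⟩
      cases o <;> simp only [turnOut] <;> omega
    · exact huv a (List.mem_append_right _ (List.mem_of_mem_tail ha))
  suffices ∃ u v, w = u ++ v ∧ store (u ++ turnOut o :: v.tail) = s ∧
      (∀ a ∈ u, a ≠ barrier o) ∧ v.headD (k + 2) = turnIn k o by
    obtain ⟨u, v, rfl, hs, hu, hv⟩ := this
    obtain ⟨ρ', hr, h⟩ := roundtrip hI (fun a ha => ⟨hw a (by simp [ha]), hu a ha⟩) hv h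
    exact ⟨_, ρ', hs, plain u v hw, hr, h⟩
  cases o with
  | nop =>
    refine ⟨w, [], by simp, ?_, fun a ha => (hw a ha).2, rfl⟩
    obtain rfl : s = _ := hs
    simpa [turnOut] using store_insert_zero w []
  | inc i =>
    refine ⟨w, [], by simp, ?_, fun a ha => (hw a ha).2, rfl⟩
    obtain rfl : s = _ := hs
    simpa [turnOut] using store_insert_token w [] i
  | zero i =>
    obtain ⟨h₀, rfl⟩ := hs
    refine ⟨w, [], by simp, by simpa [turnOut] using store_insert_zero w [], ?_, rfl⟩
    rintro a ha rfl
    exact List.count_eq_zero.1 h₀ ha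
  | dec i =>
    have hs : store w = Function.update s i (s i + 1) := hs
    have hi : 2 + i ∈ w := by
      have := congrFun hs i
      rw [Function.update_self] at this
      exact List.count_pos_iff.1 (by unfold store at this; omega)
    obtain ⟨u, v, rfl⟩ := List.append_of_mem hi
    refine ⟨u, (2 + i) :: v, rfl, ?_, fun a ha => (hw a (by simp [ha])).2, rfl⟩
    rw [store_insert_token] at hs
    simp only [turnOut, List.tail_cons, store_insert_zero]
    funext j
    have := congrFun hs j
    by_cases hj : j = i
    · subst hj
      simpa using this
    · simpa [Function.update_of_ne hj] using this

theorem simulate {q q' : ℕ} {s : Store} (hB : Bounded k n I) {w : List ℕ}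
    (hs : Relation.TransGen I.Step (q, store w) (q', s)) (hw : ∀ a ∈ w, Plain k a) {ρ : Config}
    (h : Split k (stL k q) [] (1 :: w) ρ) :
    ∃ w' ρ', store w' = s ∧ (∀ a ∈ w', Plain k a) ∧ Relation.TransGen (machine k n I).Next ρ ρ' ∧
      Split k (stL k q') [] (1 :: w') ρ' := by
  have : ∀ y : ℕ × Store, Relation.TransGen I.Step (q, store w) y → ∃ w' ρ', store w' = y.2 ∧
      (∀ a ∈ w', Plain k a) ∧ Relation.TransGen (machine k n I).Next ρ ρ' ∧
        Split k (stL k y.1) [] (1 :: w') ρ' := by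
    intro y hy
    induction hy with
    | single hy =>
      obtain ⟨o, hI, ho⟩ := hy
      exact simulate_step hI (hB _ _ _ hI).2.2 ho hw h
    | tail _ hy ih =>
      obtain ⟨o, hI, ho⟩ := hy
      obtain ⟨w₁, ρ₁, hw₁, hp, hr, h⟩ := ih
      rw [← hw₁] at ho
      obtain ⟨w₂, ρ₂, h₁, h₂, h₃, h₄⟩ := simulate_step (n := n) hI (hB _ _ _ hI).2.2 ho hp h
      exact ⟨w₂, ρ₂, h₁, h₂, hr.trans h₃, h₄⟩
  exact this _ hs

theorem exists_recurring (hB : Bounded k n I) (hn : 0 < n) {s : ℕ → Store} (h₀ : s 0 = 0)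
    (hs : ∀ i, Relation.TransGen I.Step (0, s i) (0, s (i + 1))) :
    ∃ ρ, WFConfig (machine k n I) ρ ∧ RecurringFrom (machine k n I) (stL k 0) ρ := by
  refine ⟨([1, k + 2], 0, stL k 0), ⟨by simp, by simp [machine, NTM.blank], ?_, ?_, ?_⟩, ?_⟩
  · intro i j hij hj h
    simp only [List.length_cons, List.length_nil, zero_add] at hj
    simp only [machine, NTM.blank] at *
    have : j = 1 ∨ (i = 0 ∧ j = 0) := by omega
    rcases this with rfl | ⟨rfl, rfl⟩
    · simp
    · exact h
  · simp [machine, NTM.blank]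
  · simpa [stL, machine, NTM.numStates] using ⟨width_pos, hn⟩
  · refine exists_recurring_chain (P := fun ρ => ρ.2.2 = stL k 0) (fun i ρ => ∃ w,
      store w = s i ∧ (∀ a ∈ w, Plain k a) ∧ Split k (stL k 0) [] (1 :: w) ρ) ?_ ?_
    · rintro i ρ ⟨w, hw, hp, h⟩
      have := hs i
      rw [← hw] at this
      obtain ⟨w', ρ', h₁, h₂, h₃, h₄⟩ := simulate hB this hp h
      obtain ⟨m, rfl⟩ := h
      exact ⟨rfl, ρ', ⟨w', h₁, h₂, h₄⟩, h₃⟩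
    · refine ⟨[], ?_, by simp, 0, by simp⟩
      rw [h₀]
      rfl

variable {k n : ℕ} {I : Instrs}

/-! #### The counter machine simulates the Turing machine -/

theorem Split.state {s : ℕ} {x y : List ℕ} {ρ : Config} (h : Split k s x y ρ) : ρ.2.2 = s := by
  obtain ⟨m, rfl⟩ := h
  rfl

/-- The invariant of runs of the simulating machine on arbitrary configurations: no blank occurs
in the part of the tape which has been visited. -/
def Clean (k : ℕ) (ρ : Config) : Prop :=
  ∃ s x y, Split k s x y ρ ∧ (∀ a ∈ y.tail, a < k + 2) ∧
    ((∃ o q, o.Below k ∧ s = stR k o q) → ∀ a ∈ y, a < k + 2)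

theorem Clean.next (hB : Bounded k n I) {ρ ρ' : Config} (h : Clean k ρ)
    (hn : (machine k n I).Next ρ ρ') : Clean k ρ' := by
  obtain ⟨s, x, y, h, ht, hy⟩ := h
  obtain ⟨s', b, d, he, hs⟩ := h.next hn
  rcases eq_stL_or_stR hB he with ⟨q, rfl⟩ | ⟨o, q, ho, rfl⟩
  · rcases mem_table_stL hB he with ⟨h₁, -, rfl, rfl, rfl⟩ | ⟨-, o, q', hI, rfl, -, rfl⟩
    · rcases hs with ⟨hd, -⟩ | ⟨-, x', c, rfl, h'⟩
      · simp at hd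
      · refine ⟨_, _, _, h', ?_, ?_⟩
        · simpa only [List.tail_cons, List.forall_mem_cons] using ⟨h₁, ht⟩
        · rintro ⟨o, q', ho, hq⟩
          exact (stL_ne_stR ho hq).elim
    · rcases hs with ⟨-, h⟩ | ⟨hd, -⟩
      · exact ⟨_, _, _, h, fun a ha => ht a (List.mem_of_mem_tail ha), fun _ => ht⟩
      · simp at hd
  · rcases mem_table_stR hB ho he with ⟨-, -, -, rfl, -, rfl⟩ | ⟨-, rfl, rfl, rfl⟩
    · rcases hs with ⟨-, h⟩ | ⟨hd, -⟩
      · exact ⟨_, _, _, h, fun a ha => ht a (List.mem_of_mem_tail ha), fun _ => ht⟩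
      · simp at hd
    · rcases hs with ⟨hd, -⟩ | ⟨-, x', c, rfl, h'⟩
      · simp at hd
      · refine ⟨_, _, _, h', ?_, ?_⟩
        · simpa using ⟨turnOut_lt ho, ht⟩
        · rintro ⟨o, q', ho, hq⟩
          exact (stL_ne_stR ho hq).elim

theorem exists_eq_append_replicate {b : ℕ} (D : List ℕ) (hD : D.getLast? = some b)
    (hcl : ∀ i j, i ≤ j → j < D.length → D.getD i 0 = b → D.getD j 0 = b) (hle : ∀ a ∈ D, a ≤ b) :
    ∃ y m, D = y ++ List.replicate (m + 1) b ∧ ∀ a ∈ y, a < b := by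
  induction D with
  | nil => simp at hD
  | cons a D ih =>
    by_cases ha : a = b
    · refine ⟨[], D.length, ?_, by simp⟩
      rw [List.nil_append, List.eq_replicate_iff]
      refine ⟨rfl, fun c hc => ?_⟩
      obtain ⟨j, hj, rfl⟩ := List.getElem_of_mem hc
      have := hcl 0 j (Nat.zero_le j) hj (by simpa using ha)
      rwa [List.getD_eq_getElem _ _ hj] at this
    · cases D with
      | nil => simp [ha] at hD
      | cons a' D =>
        obtain ⟨y, m, h, hy⟩ := ih (by rwa [List.getLast?_cons_cons] at hD)
          (fun i j hij hj hi => by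
            have := hcl (i + 1) (j + 1) (by omega) (Nat.succ_lt_succ hj)
            rw [List.getD_cons_succ, List.getD_cons_succ] at this
            exact this hi) (fun c hc => hle c (List.mem_cons_of_mem _ hc))
        refine ⟨a :: y, m, by rw [h]; rfl, ?_⟩
        intro c hc
        rcases List.mem_cons.1 hc with rfl | hc
        · exact lt_of_le_of_ne (hle c (by simp)) ha
        · exact hy c hc

theorem clean_of_wfConfig {ρ : Config} (h : WFConfig (machine k n I) ρ) : Clean k ρ := by
  obtain ⟨T, p, s⟩ := ρ
  obtain ⟨hp, hl, hcl, hle, -⟩ := h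
  simp only [show (machine k n I).blank = k + 2 from rfl] at *
  obtain ⟨y, m, hy, hlt⟩ := exists_eq_append_replicate (b := k + 2) (T.drop p)
    (by rw [List.getLast?_drop, if_neg (by omega), hl])
    (fun i j hij hj h => by
      rw [List.length_drop] at hj
      have := hcl (p + i) (p + j) (by omega) (by omega)
      simp only [List.getD_eq_getElem?_getD, List.getElem?_drop] at h this ⊢
      exact this h)
    (fun a ha => hle a (List.mem_of_mem_drop ha))
  refine ⟨s, T.take p, y, ⟨m, ?_⟩, fun a ha => hlt a (List.mem_of_mem_tail ha), fun _ => hlt⟩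
  rw [List.append_assoc, ← hy, List.take_append_drop, List.length_take, min_eq_left hp.le]

/-- The head is at a marker, in the state walking left in order to continue in state `0`. -/
def Marked (k : ℕ) (x w : List ℕ) (ρ : Config) : Prop :=
  Split k (stL k 0) x (1 :: w) ρ ∧ ∀ a ∈ w, a < k + 2

theorem eq_cons_of_headD {y : List ℕ} {d c : ℕ} (h : y.headD d = c) (hc : c ≠ d) :
    y = c :: y.tail := by
  cases y with
  | nil => exact (hc h.symm).elim
  | cons a y => exact congrArg (· :: y) h

theorem exists_marked (hB : Bounded k n I) {c : ℕ → Config}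
    (hc : ∀ i, (machine k n I).Next (c i) (c (i + 1))) (l : ℕ) : ∀ t x y, x.length = l →
      Split k (stL k 0) x y (c t) → (∀ a ∈ y.tail, a < k + 2) → ∃ t x w, Marked k x w (c t) := by
  induction l with
  | zero =>
    intro t x y hx h ht
    obtain rfl := List.length_eq_zero_iff.1 hx
    obtain ⟨s', b, d, he, hs⟩ := h.next (hc t)
    rcases mem_table_stL hB he with ⟨h₁, -, rfl, rfl, rfl⟩ | ⟨h₁, o, q', hI, rfl, -, rfl⟩
    · rcases hs with ⟨hd, -⟩ | ⟨-, x', c, hx, -⟩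
      · simp at hd
      · simp at hx
    · rw [eq_cons_of_headD h₁ (by omega)] at h
      exact ⟨t, _, _, h, ht⟩
  | succ l ih =>
    intro t x y hx h ht
    obtain ⟨s', b, d, he, hs⟩ := h.next (hc t)
    rcases mem_table_stL hB he with ⟨h₁, -, rfl, rfl, rfl⟩ | ⟨h₁, o, q', hI, rfl, -, rfl⟩
    · rcases hs with ⟨hd, -⟩ | ⟨-, x', c, rfl, h'⟩
      · simp at hd
      · exact ih (t + 1) x' _ (by simpa using hx) h'
          (by simpa only [List.tail_cons, List.forall_mem_cons] using ⟨h₁, ht⟩)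
    · rw [eq_cons_of_headD h₁ (by omega)] at h
      exact ⟨t, _, _, h, ht⟩

/-- The invariant of runs of the simulating machine which started from the marker right of `x`
with the store `s₀`. -/
inductive Tracked (k : ℕ) (I : Instrs) (x : List ℕ) (s₀ : Store) (ρ : Config) : Prop
  | left (q c : ℕ) (u v x' : List ℕ)
      (steps : Relation.TransGen I.Step (0, s₀) (q, store (u ++ v)))
      (lt : ∀ a ∈ u ++ v, a < k + 2) (eq : x' ++ [c] = x ++ 1 :: u) (not_mem : 1 ∉ u)
      (split : Split k (stL k q) x' (c :: v) ρ)
  | right (q q' : ℕ) (o : Op) (u v : List ℕ)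
      (steps : Relation.ReflTransGen I.Step (0, s₀) (q, store (u ++ v))) (mem : (q, o, q') ∈ I)
      (lt : ∀ a ∈ u ++ v, a < k + 2) (not_mem : 1 ∉ u) (barrier_not_mem : barrier o ∉ u)
      (split : Split k (stR k o q') (x ++ 1 :: u) v ρ)

theorem Tracked.of_marker (hB : Bounded k n I) {x w : List ℕ} {s₀ : Store} {ρ ρ' : Config} {q : ℕ}
    (hs : Relation.ReflTransGen I.Step (0, s₀) (q, store w)) (hw : ∀ a ∈ w, a < k + 2)
    (h : Split k (stL k q) x (1 :: w) ρ) (hn : (machine k n I).Next ρ ρ') :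
    Tracked k I x s₀ ρ' := by
  obtain ⟨s', b, d, he, hd⟩ := h.next hn
  rcases mem_table_stL hB he with ⟨-, h₁, -⟩ | ⟨-, o, q', hI, rfl, rfl, rfl⟩
  · exact (h₁ rfl).elim
  · rcases hd with ⟨-, h⟩ | ⟨hd, -⟩
    · exact .right q q' o [] w hs hI hw (by simp) (by simp) h
    · simp at hd

theorem rel_store_turn {o : Op} (ho : o.Below k) {u v : List ℕ} (hv : v.headD (k + 2) = turnIn k o)
    (hlt : ∀ a ∈ v, a < k + 2) (hu : barrier o ∉ u) :
    o.Rel (store (u ++ v)) (store (u ++ turnOut o :: v.tail)) := by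
  have nil : turnIn k o = k + 2 → v = [] := by
    intro h
    cases v with
    | nil => rfl
    | cons a v =>
      have := hlt a (by simp)
      simp only [List.headD_cons] at hv
      omega
  cases o with
  | nop =>
    obtain rfl := nil rfl
    exact store_insert_zero u []
  | inc i =>
    obtain rfl := nil rfl
    exact store_insert_token u [] i
  | zero i =>
    obtain rfl := nil rfl
    refine ⟨?_, store_insert_zero u []⟩
    rw [List.append_nil]
    exact List.count_eq_zero.2 hu
  | dec i =>
    have hi : i < k := ho
    rw [eq_cons_of_headD hv (by simp only [turnIn]; omega)]
    simp only [turnIn, turnOut, List.tail_cons, store_insert_zero, store_insert_token]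
    rfl

theorem Tracked.next (hB : Bounded k n I) {x : List ℕ} {s₀ : Store} {ρ ρ' : Config}
    (h : Tracked k I x s₀ ρ) (hn : (machine k n I).Next ρ ρ') : Tracked k I x s₀ ρ' := by
  cases h with
  | left q c u v x' hs hlt hx hu h =>
    rcases List.eq_nil_or_concat' u with rfl | ⟨u, a, rfl⟩
    · obtain ⟨rfl, rfl⟩ := List.append_singleton_inj.1 hx
      exact .of_marker hB hs.to_reflTransGen hlt h hn
    · obtain ⟨rfl, rfl⟩ : x' = x ++ 1 :: u ∧ c = a := by
        rw [← List.cons_append, ← List.append_assoc] at hx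
        exact List.append_singleton_inj.1 hx
      obtain ⟨s', b, d, he, hd⟩ := h.next hn
      rcases mem_table_stL hB he with ⟨-, -, rfl, rfl, rfl⟩ | ⟨h₁, -⟩
      · rcases hd with ⟨hd, -⟩ | ⟨-, x'', c', hx', h⟩
        · simp at hd
        · simp only [List.append_assoc, List.singleton_append] at hs hlt
          exact .left q c' u _ x'' hs hlt hx'.symm (fun h => hu (by simp [h])) h
      · rw [List.headD_cons] at h₁
        exact (hu (by simp [h₁])).elim
  | right q q' o u v hs hI hlt hu hu' h =>
    have ho := (hB _ _ _ hI).2.2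
    obtain ⟨s', b, d, he, hd⟩ := h.next hn
    rcases mem_table_stR hB ho he with ⟨h₁, h₂, h₃, rfl, rfl, rfl⟩ | ⟨h₁, rfl, rfl, rfl⟩
    · rcases hd with ⟨-, h⟩ | ⟨hd, -⟩
      · have hv := eq_cons_of_headD (y := v) rfl (Nat.ne_of_lt h₁)
        generalize v.headD (k + 2) = a at *
        rw [hv, List.append_cons] at hs hlt
        exact .right q q' o (u ++ [a]) v.tail (by simpa using hs) hI (by simpa using hlt)
          (by simpa using ⟨hu, h₂.symm⟩) (by simpa using ⟨hu', h₃.symm⟩) (by simpa using h)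
      · simp at hd
    · rcases hd with ⟨hd, -⟩ | ⟨-, x', c, hx, h⟩
      · simp at hd
      · refine .left q' c u _ x' (Relation.TransGen.tail' hs ⟨o, hI, rel_store_turn ho h₁
          (fun a ha => hlt a (by simp [ha])) hu'⟩) ?_ hx.symm hu h
        intro a ha
        rcases List.mem_append.1 ha with ha | ha
        · exact hlt a (by simp [ha])
        rcases List.mem_cons.1 ha with rfl | ha
        · exact turnOut_lt ho
        · exact hlt a (by simp [List.mem_of_mem_tail ha])

theorem exists_marked_of_left (hB : Bounded k n I) {c : ℕ → Config}
    (hc : ∀ i, (machine k n I).Next (c i) (c (i + 1))) {x : List ℕ} (u : List ℕ) :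
    ∀ t x' a v, (∀ a ∈ u ++ v, a < k + 2) → x' ++ [a] = x ++ 1 :: u → 1 ∉ u →
      Split k (stL k 0) x' (a :: v) (c t) → ∃ t' ≥ t, Marked k x (u ++ v) (c t') := by
  induction u using List.reverseRecOn with
  | nil =>
    intro t x' a v hlt hx _ h
    obtain ⟨rfl, rfl⟩ := List.append_singleton_inj.1 hx
    exact ⟨t, le_rfl, h, hlt⟩
  | append_singleton u b ih =>
    intro t x' a v hlt hx hu h
    obtain ⟨rfl, rfl⟩ : x' = x ++ 1 :: u ∧ a = b := by
      rw [← List.cons_append, ← List.append_assoc] at hx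
      exact List.append_singleton_inj.1 hx
    obtain ⟨s', b, d, he, hd⟩ := h.next (hc t)
    rcases mem_table_stL hB he with ⟨-, -, rfl, rfl, rfl⟩ | ⟨h₁, -⟩
    · rcases hd with ⟨hd, -⟩ | ⟨-, x'', c', hx', h⟩
      · simp at hd
      · simp only [List.append_assoc, List.singleton_append] at hlt ⊢
        obtain ⟨t', ht, h⟩ := ih (t + 1) x'' c' _ hlt hx'.symm (fun h => hu (by simp [h])) h
        exact ⟨t', by omega, h⟩
    · rw [List.headD_cons] at h₁
      exact (hu (by simp [h₁])).elim

theorem Marked.exists_next (hB : Bounded k n I) {c : ℕ → Config}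
    (hc : ∀ i, (machine k n I).Next (c i) (c (i + 1)))
    (hr : ∀ N, ∃ i, N ≤ i ∧ (c i).2.2 = stL k 0) {t : ℕ} {x w : List ℕ} (h : Marked k x w (c t)) :
    ∃ t' w', Marked k x w' (c t') ∧ Relation.TransGen I.Step (0, store w) (0, store w') := by
  have tracked : ∀ j, Tracked k I x (store w) (c (t + 1 + j)) := by
    intro j
    induction j with
    | zero => exact .of_marker hB .refl h.2 h.1 (hc t)
    | succ j ih => exact ih.next hB (hc _)
  obtain ⟨i, hi, hq⟩ := hr (t + 1)
  obtain ⟨j, rfl⟩ := Nat.exists_eq_add_of_le hi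
  cases tracked j with
  | left q a u v x' hs hlt hx hu h =>
    obtain rfl : q = 0 := stL_inj (h.state.symm.trans hq)
    obtain ⟨t', -, h'⟩ := exists_marked_of_left hB hc u _ x' a v hlt hx hu h
    exact ⟨t', _, h', hs⟩
  | right q q' o u v hs hI _ _ _ h =>
    exact (stL_ne_stR (hB _ _ _ hI).2.2 (hq.symm.trans h.state)).elim

theorem exists_transGen_of_recurring (hB : Bounded k n I) {ρ : Config}
    (hρ : WFConfig (machine k n I) ρ) (h : RecurringFrom (machine k n I) (stL k 0) ρ) :
    ∃ s : ℕ → Store, ∀ i, Relation.TransGen I.Step (0, s i) (0, s (i + 1)) := by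
  obtain ⟨c, h₀, hc, hr⟩ := h
  have clean : ∀ t, Clean k (c t) := by
    intro t
    induction t with
    | zero => exact h₀ ▸ clean_of_wfConfig hρ
    | succ t ih => exact ih.next hB (hc t)
  obtain ⟨t, -, ht⟩ := hr 0
  obtain ⟨s, x, y, h, hy, -⟩ := clean t
  obtain rfl : s = stL k 0 := h.state.symm.trans ht
  obtain ⟨t, x, w, h⟩ := exists_marked hB hc _ t x y rfl h hy
  let V := {w : List ℕ // ∃ t, Marked k x w (c t)}
  have step : ∀ v : V, ∃ v' : V, Relation.TransGen I.Step (0, store v.1) (0, store v'.1) := by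
    rintro ⟨w, t, h⟩
    obtain ⟨t', w', h', hs⟩ := h.exists_next hB hc hr
    exact ⟨⟨w', t', h'⟩, hs⟩
  choose f hf using step
  refine ⟨fun i => store (f^[i] ⟨w, t, h⟩).1, fun i => ?_⟩
  beta_reduce
  rw [Function.iterate_succ_apply']
  exact hf _

end Simul

/-! ### Hardness -/

/-- Whether `R` holds for some prefix of the given list. -/
def anyPrefix {α : Type} (R : α → List ℕ → Bool) (a : α) (l : List ℕ) : Bool :=
  Nat.rec false (fun i b => b || R a (l.take i)) (l.length + 1)

theorem anyPrefix_eq_false {α : Type} {R : α → List ℕ → Bool} {a : α} {l : List ℕ} :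
    anyPrefix R a l = false ↔ ∀ i ≤ l.length, R a (l.take i) = false := by
  have : ∀ n, (Nat.rec false (fun i b => b || R a (l.take i)) n : Bool) = false ↔
      ∀ i < n, R a (l.take i) = false := by
    intro n
    induction n with
    | zero => simp
    | succ n ih =>
      rw [Nat.forall_lt_succ_right, ← ih]
      exact Bool.or_eq_false_iff
  exact (this (l.length + 1)).trans (forall_congr' fun i => by rw [Nat.lt_succ_iff])

theorem computable₂_anyPrefix {α : Type} [Primcodable α] {R : α → List ℕ → Bool}
    (hR : Computable₂ R) : Computable₂ (anyPrefix R) := by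
  have h : Computable fun p : (α × List ℕ) × ℕ × Bool => R p.1.1 (p.1.2.take p.2.1) :=
    hR.comp (Computable.fst.comp .fst) (Primrec.list_take.to_comp.comp
      (Computable.fst.comp .snd) (Computable.snd.comp .fst))
  have h : Computable₂ fun (p : α × List ℕ) (q : ℕ × Bool) => q.2 || R p.1 (p.2.take q.1) :=
    Primrec.or.to_comp.comp (Computable.snd.comp .snd) h
  exact Computable.nat_rec (Computable.succ.comp (Computable.list_length.comp .snd))
    (.const false) h

/-- `x'` codes a one element extension of the list coded by `x`, all of whose prefixes
fail to satisfy `R a`. -/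
def Extends (R : ℕ → List ℕ → Bool) (a x x' : ℕ) : Prop :=
  anyPrefix R a (Denumerable.ofNat (List ℕ) x) = false ∧
    ∃ b, Denumerable.ofNat (List ℕ) x' = Denumerable.ofNat (List ℕ) x ++ [b]

/-- One more than the code of the extension of a list by an element, or `0` if some prefix of the
list satisfies `R`. -/
def extend (R : ℕ → List ℕ → Bool) (p : ℕ) : ℕ :=
  bif anyPrefix R p.unpair.1 (Denumerable.ofNat (List ℕ) p.unpair.2.unpair.1) then 0 else
    Encodable.encode (Denumerable.ofNat (List ℕ) p.unpair.2.unpair.1 ++ [p.unpair.2.unpair.2]) + 1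

theorem computable_extend {R : ℕ → List ℕ → Bool} (hR : Computable₂ R) :
    Computable (extend R) := by
  have h₁ : Computable fun p : ℕ => p.unpair.1 := (Primrec.fst.comp .unpair).to_comp
  have h₂ : Computable fun p : ℕ => Denumerable.ofNat (List ℕ) p.unpair.2.unpair.1 :=
    ((Primrec.ofNat (List ℕ)).comp
      (Primrec.fst.comp (Primrec.unpair.comp (Primrec.snd.comp .unpair)))).to_comp
  have h₃ : Computable fun p : ℕ => p.unpair.2.unpair.2 :=
    (Primrec.snd.comp (Primrec.unpair.comp (Primrec.snd.comp .unpair))).to_comp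
  exact Computable.cond ((computable₂_anyPrefix hR).comp h₁ h₂) (.const 0)
    (Computable.succ.comp (Computable.encode.comp (Computable.list_concat.comp h₂ h₃)))

theorem extends_iff {R : ℕ → List ℕ → Bool} {a x x' : ℕ} :
    Extends R a x x' ↔ ∃ b, extend R (Nat.pair a (Nat.pair x b)) = x' + 1 := by
  simp only [extend, Extends, Nat.unpair_pair]
  cases anyPrefix R a (Denumerable.ofNat (List ℕ) x) with
  | true => simp
  | false =>
    simp only [true_and, cond_false, Nat.add_right_cancel_iff]
    refine exists_congr fun b => ⟨fun h => ?_, fun h => ?_⟩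
    · rw [← h, Denumerable.encode_ofNat]
    · rw [← h, Denumerable.ofNat_encode]

theorem checkable_extends {R : ℕ → List ℕ → Bool} (hR : Computable₂ R) :
    Checkable fun w : Fin 3 → ℕ => Extends R (w 1) (w 0) (w 2) := by
  have hf : CheckableGraph (extend R) :=
    (Partrec.nat_iff.1 (computable_extend hR)).checkableGraph
  open Checkable in
  refine of_iff (ex (A := fun w b => ∃ y p z, y = Nat.pair (w 0) b ∧ p = Nat.pair (w 1) y ∧
    z ∈ (extend R : ℕ →. ℕ) p ∧ z = w 2 + 1) (ex (A := fun w y => ∃ p z, y = Nat.pair (w (some 0))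
    (w none) ∧ p = Nat.pair (w (some 1)) y ∧ z ∈ (extend R : ℕ →. ℕ) p ∧ z = w (some 2) + 1)
    (ex (A := fun w p => ∃ z, w none = Nat.pair (w (some (some 0))) (w (some none)) ∧
    p = Nat.pair (w (some (some 1))) (w none) ∧ z ∈ (extend R : ℕ →. ℕ) p ∧
    z = w (some (some 2)) + 1)
      (ex (A := fun w z => w (some none) = Nat.pair (w (some (some (some 0))))
    (w (some (some none))) ∧ w none = Nat.pair (w (some (some (some 1)))) (w (some none)) ∧
    z ∈ (extend R : ℕ →. ℕ) (w none) ∧ z = w (some (some (some 2))) + 1)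
    (and (pair _ _ _) (and (pair _ _ _) (and (hf _ _) (eq_succ _ _)))))))) fun w => ?_
  rw [extends_iff]
  simp [eq_comm]

/-- For a program checking `Extends R` and a program checking `s 0 = s 2`, a program which
replaces the contents of the counters `0` and `1` by an extension and by `0`. -/
def extendProg (P Q : Prog) : Prog :=
  .seq (.guess 2) (.seq P (.seq (.guess 0) (.seq Q (.seq (.guess 1) (.atom (.zero 1))))))

theorem extendProg_sound {R : ℕ → List ℕ → Bool} {P Q : Prog}
    (hP : P.Checks 3 fun s => Extends R (s 1) (s 0) (s 2)) (hQ : Q.Checks 3 fun s => s 0 = s 2)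
    {s s' : Store} (h : (extendProg P Q).Rel s s') :
    Extends R (s 1) (s 0) (s' 0) ∧ s' 1 = 0 := by
  obtain ⟨t₁, h₁, t₂, h₂, t₃, h₃, t₄, h₄, t₅, h₅, h₆, rfl⟩ := h
  replace h₁ := Prog.guess_sound h₁
  replace h₃ := Prog.guess_sound h₃
  replace h₅ := Prog.guess_sound h₅
  obtain ⟨hT, h₂⟩ := hP.1 _ _ h₂
  obtain ⟨hE, h₄⟩ := hQ.1 _ _ h₄
  refine ⟨?_, h₆⟩
  rw [h₁ 1 (by decide), h₁ 0 (by decide)] at hT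
  rwa [h₅ 0 (by decide), h₄ 0 (by decide), hE, h₃ 2 (by decide), h₂ 2 (by decide)]

theorem extendProg_complete {R : ℕ → List ℕ → Bool} {P Q : Prog}
    (hP : P.Checks 3 fun s => Extends R (s 1) (s 0) (s 2)) (hQ : Q.Checks 3 fun s => s 0 = s 2)
    {s : Store} {x : ℕ} (h : Extends R (s 1) (s 0) x) :
    ∃ s', (extendProg P Q).Rel s s' ∧ s' 0 = x ∧ s' 1 = 0 := by
  obtain ⟨t₂, h₂⟩ := hP.2 (Function.update s 2 x) (by simpa using h)
  obtain ⟨t₄, h₄⟩ := hQ.2 (Function.update t₂ 0 x) (by simp [(hP.1 _ _ h₂).2 2 (by decide)])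
  refine ⟨Function.update t₄ 1 0, ⟨_, Prog.guess_complete 2 x s, t₂, h₂, _,
    Prog.guess_complete 0 x t₂, t₄, h₄, _, Prog.guess_complete 1 0 t₄, by simp, rfl⟩, ?_, by simp⟩
  simp [(hQ.1 _ _ h₄).2 0 (by decide)]

theorem map_range_eq_take {l : ℕ → List ℕ} (hl : ∀ i, ∃ b, l (i + 1) = l i ++ [b]) (k : ℕ) :
    (List.range k).map (fun j => (l (j + 1)).getD j 0) = (l k).take k := by
  have hlen : ∀ i, i ≤ (l i).length := by
    intro i
    induction i with
    | zero => exact Nat.zero_le _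
    | succ i ih =>
      obtain ⟨b, hb⟩ := hl i
      simpa [hb] using ih
  have hpre : ∀ i d, l i <+: l (i + d) := by
    intro i d
    induction d with
    | zero => exact List.prefix_rfl
    | succ d ih =>
      obtain ⟨b, hb⟩ := hl (i + d)
      rw [← add_assoc, hb]
      exact ih.trans (List.prefix_append _ _)
  refine List.ext_getElem (by simp [hlen k]) fun j h₁ h₂ => ?_
  have hj : j < k := by simpa using h₁
  obtain ⟨d, rfl⟩ := Nat.exists_eq_add_of_lt hj
  have := hlen (j + 1)
  simp only [List.getElem_map, List.getElem_range, List.getElem_take]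
  rw [List.getD_eq_getElem _ _ (by omega)]
  have := hpre (j + 1) d
  rw [show j + 1 + d = j + d + 1 by omega] at this
  exact this.getElem _

theorem exists_fun_of_extends {R : ℕ → List ℕ → Bool} {a : ℕ} {x : ℕ → ℕ}
    (h : ∀ i, Extends R a (x i) (x (i + 1))) :
    ∃ f : ℕ → ℕ, ∀ k, R a ((List.range k).map f) = false := by
  refine ⟨fun j => (Denumerable.ofNat (List ℕ) (x (j + 1))).getD j 0, fun k => ?_⟩
  rw [map_range_eq_take (l := fun i => Denumerable.ofNat (List ℕ) (x i)) fun i => (h i).2]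
  by_cases hk : k ≤ (Denumerable.ofNat (List ℕ) (x k)).length
  · exact anyPrefix_eq_false.1 (h k).1 k hk
  · rw [List.take_of_length_le (by omega)]
    simpa using anyPrefix_eq_false.1 (h k).1 _ le_rfl

theorem extends_of_fun {R : ℕ → List ℕ → Bool} {a : ℕ} {f : ℕ → ℕ}
    (h : ∀ k, R a ((List.range k).map f) = false) (k : ℕ) :
    Extends R a (Encodable.encode ((List.range k).map f))
      (Encodable.encode ((List.range (k + 1)).map f)) := by
  refine ⟨?_, f k, by simp [List.range_succ]⟩
  rw [anyPrefix_eq_false, Denumerable.ofNat_encode]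
  intro i hi
  rw [← List.map_take, List.take_range, h]

section

variable {R : ℕ → List ℕ → Bool} {P Q : Prog} {a : ℕ}

theorem exists_fun_of_loop (hP : P.Checks 3 fun s => Extends R (s 1) (s 0) (s 2))
    (hQ : Q.Checks 3 fun s => s 0 = s 2) {s : ℕ → Store}
    (hs : ∀ i, Relation.TransGen ((extendProg P Q).loop a).Step (0, s i) (0, s (i + 1))) :
    ∃ f : ℕ → ℕ, ∀ k, R a ((List.range k).map f) = false := by
  obtain ⟨c, -, hc⟩ := exists_chain_of_transGen fun i => Prog.LoopRel.of_transGen (hs i)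
  refine exists_fun_of_extends (x := fun i => c (i + 1) 0) fun i => ?_
  have := (extendProg_sound hP hQ (hc (i + 1))).1
  simpa [(extendProg_sound hP hQ (hc i)).2] using this

theorem exists_loop_of_fun (hP : P.Checks 3 fun s => Extends R (s 1) (s 0) (s 2))
    (hQ : Q.Checks 3 fun s => s 0 = s 2) {f : ℕ → ℕ}
    (hf : ∀ k, R a ((List.range k).map f) = false) :
    ∃ s : ℕ → Store, s 0 = 0 ∧
      ∀ i, Relation.TransGen ((extendProg P Q).loop a).Step (0, s i) (0, s (i + 1)) := by
  obtain ⟨s, h₀, hs, -⟩ := exists_recurring_chain (r := (extendProg P Q).LoopRel a)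
    (P := fun _ => True) (x := 0)
    (fun i s => s 0 = Encodable.encode ((List.range i).map f) ∧ s 1 = 0) (by
      rintro i s ⟨h₀, h₁⟩
      have := extends_of_fun hf i
      rw [← h₀] at this
      obtain ⟨s', h, h₂⟩ := extendProg_complete hP hQ (s := Function.update s 1 (s 1 + a))
        (by simpa [h₁] using this)
      exact ⟨trivial, s', h₂, .single h⟩) ⟨rfl, rfl⟩
  exact ⟨s, h₀, fun i => (hs i).transGen⟩

end

theorem Op.Below.mono {o : Op} {k m : ℕ} (h : o.Below k) (hkm : k ≤ m) : o.Below m := by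
  cases o <;> simp only [Op.Below] at * <;> omega

theorem Instrs.exists_below (I : Instrs) : ∃ k > 1, ∀ q o q', (q, o, q') ∈ I → o.Below k := by
  induction I with
  | nil => exact ⟨2, by simp, by simp⟩
  | cons e I ih =>
    obtain ⟨k, hk, h⟩ := ih
    obtain ⟨m, hm⟩ : ∃ m, e.2.1.Below m := by
      cases e.2.1 with
      | nop => exact ⟨0, trivial⟩
      | inc i => exact ⟨i + 1, Nat.lt_succ_self i⟩
      | dec i => exact ⟨i + 1, Nat.lt_succ_self i⟩
      | zero i => exact ⟨i + 1, Nat.lt_succ_self i⟩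
    refine ⟨max k m, lt_max_of_lt_left hk, fun q o q' he => ?_⟩
    rcases List.mem_cons.1 he with rfl | he
    · exact hm.mono (le_max_right _ _)
    · exact (h _ _ _ he).mono (le_max_left _ _)

theorem Prog.bounded_loop {p : Prog} {k : ℕ} (hk : 1 < k)
    (h : ∀ q o q', (q, o, q') ∈ p.instrs → o.Below k) (a : ℕ) :
    Simul.Bounded k (p.states.length + a + 1) (p.loop a) := by
  have hp := code_lt (singleton_mem_states p)
  intro q o q' hI
  rcases mem_loop.1 hI with hI | ⟨rfl, rfl, rfl⟩ | ⟨j, hj, rfl, rfl, rfl⟩ | ⟨rfl, rfl, rfl⟩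
  · have ho := h _ _ _ hI
    obtain ⟨C, hC, e, he, rfl, rfl, rfl⟩ := mem_instrs.1 hI
    have h₁ := code_lt hC
    have h₂ := code_lt (mem_states_of_mem_succs hC he)
    exact ⟨by omega, by omega, ho⟩
  · exact ⟨by omega, by omega, trivial⟩
  · exact ⟨by omega, by omega, hk⟩
  · exact ⟨by omega, by omega, trivial⟩

theorem Simul.primrec_entries (k : ℕ) (o : Op) :
    Primrec fun p : ℕ × ℕ => Simul.entries k o p.1 p.2 := by
  have hL : ∀ {α : Type} [Primcodable α] {f : α → ℕ}, Primrec f → Primrec fun a => stL k (f a) :=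
    fun hf => Primrec.nat_mul.comp (.const _) hf
  have hR : ∀ {α : Type} [Primcodable α] {f : α → ℕ}, Primrec f → Primrec fun a => stR k o (f a) :=
    fun hf => Primrec.nat_add.comp (hL hf) (.const _)
  have e : ∀ {α : Type} [Primcodable α] {s s' c b : α → ℕ} (d : Bool), Primrec s → Primrec c →
      Primrec s' → Primrec b → Primrec fun a => ((s a, c a), (s' a, b a, d)) :=
    fun d h₁ h₂ h₃ h₄ => .pair (.pair h₁ h₂) (.pair h₃ (.pair h₄ (.const d)))
  refine Primrec.list_append.comp (Primrec.list_append.comp (.list_map (.const _) ?_)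
    (.list_map (.const _) ?_)) (Primrec.list_cons.comp ?_ (Primrec.list_cons.comp ?_ (.const [])))
  · exact e _ (hL (Primrec.snd.comp .fst)) .snd (hL (Primrec.snd.comp .fst)) .snd
  · exact e _ (hR (Primrec.snd.comp .fst)) .snd (hR (Primrec.snd.comp .fst)) .snd
  · exact e _ (hL .fst) (.const _) (hR .snd) (.const _)
  · exact e _ (hR .snd) (.const _) (hL .snd) (.const _)

theorem Simul.primrec_machine_loop (k : ℕ) (p : Prog) :
    Primrec fun a => Simul.machine k (p.states.length + a + 1) (p.loop a) := by
  have hadd : ∀ c, Primrec fun a : ℕ => c + a := fun c => Primrec.nat_add.comp (.const c) .id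
  refine .pair ?_ (.pair (.const _) ?_)
  · exact Primrec.nat_mul.comp (.const _) (Primrec.succ.comp (hadd _))
  · simp only [Prog.loop, List.flatMap_append, List.flatMap_cons, List.flatMap_nil,
      List.flatMap_map, List.append_nil]
    refine Primrec.list_append.comp (.const _) (Primrec.list_append.comp (Primrec.list_append.comp
      (.const _) (.list_flatMap .list_range ?_)) ?_)
    · exact ((primrec_entries k (.inc 1)).comp
        (.pair (hadd _) (Primrec.succ.comp (hadd _)))).comp .snd
    · exact (primrec_entries k .nop).comp (.pair (hadd _) (.const _))

theorem robustNonRecurring_pi11Hard :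
    Pi11Hard (fun p : NTM × ℕ => NTM.WF p.1 ∧ p.2 < NTM.numStates p.1 ∧
      ∀ ρ, WFConfig p.1 ρ → NonRecurringFrom p.1 p.2 ρ) := by
  rintro q ⟨R, hR, hq⟩
  obtain ⟨P, hP⟩ := checkable_extends hR Fin.val 3 Fin.is_lt
  obtain ⟨Q, hQ⟩ := Checkable.eq (0 : Fin 3) 2 Fin.val 3 Fin.is_lt
  obtain ⟨k, hk, hb⟩ := Instrs.exists_below (extendProg P Q).instrs
  refine ⟨fun a => (Simul.machine k ((extendProg P Q).states.length + a + 1)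
    ((extendProg P Q).loop a), Simul.stL k 0),
    ((Simul.primrec_machine_loop k _).pair (.const _)).to_comp, fun a => ?_⟩
  have hB := Prog.bounded_loop hk hb a
  have hn := Nat.succ_pos ((extendProg P Q).states.length + a)
  have hst : Simul.stL k 0 < Simul.width k * ((extendProg P Q).states.length + a + 1) :=
    Nat.mul_lt_mul_of_pos_left hn Simul.width_pos
  rw [hq]
  refine ⟨fun h => ⟨Simul.machine_wf hn hB, hst, fun ρ hρ hrec => ?_⟩, fun h f => ?_⟩
  · obtain ⟨s, hs⟩ := Simul.exists_transGen_of_recurring hB hρ hrec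
    obtain ⟨f, hf⟩ := exists_fun_of_loop hP hQ hs
    obtain ⟨i, hi⟩ := h f
    rw [hf] at hi
    simp at hi
  · by_contra! hf
    obtain ⟨s, h₀, hs⟩ := exists_loop_of_fun hP hQ fun k => by simpa using hf k
    obtain ⟨ρ, hρ, hrec⟩ := Simul.exists_recurring hB hn h₀ hs
    exact h.2.2 ρ hρ hrec

/-! ### Membership -/

theorem pi11_of_chain {α σ : Type} [Primcodable α] [Primcodable σ] [Inhabited σ] {p : α → Prop}
    {Init : α → σ → Prop} {Step : α → σ → σ → Prop} (hI : PrimrecRel Init)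
    (hS : PrimrecPred fun t : α × σ × σ => Step t.1 t.2.1 t.2.2)
    (hp : ∀ a, p a ↔ ¬ ∃ c : ℕ → σ, Init a (c 0) ∧ ∀ i, Step a (c i) (c (i + 1))) : Pi11 p := by
  classical
  let dec : ℕ → σ := fun n => (Encodable.decode n : Option σ).getD default
  have hdec : Primrec dec := Primrec.option_getD.comp .decode (.const _)
  have elem : ∀ {g : List ℕ → ℕ}, Primrec g →
      Primrec fun t : α × List ℕ => dec (t.2.getD (g t.2) 0) := fun hg =>
    hdec.comp ((Primrec.list_getD 0).comp .snd (hg.comp .snd))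
  have hR : PrimrecRel fun (a : α) (l : List ℕ) => 2 ≤ l.length ∧ ¬ (Init a (dec (l.getD 0 0)) ∧
      Step a (dec (l.getD (l.length - 2) 0)) (dec (l.getD (l.length - 1) 0))) := by
    refine .and (Primrec.nat_le.comp (.const 2) (Primrec.list_length.comp .snd))
      (.not (.and (hI.comp .fst (elem (.const 0))) ?_))
    exact hS.comp (.pair .fst (.pair
      (elem (Primrec.nat_sub.comp .list_length (.const 2)))
      (elem (Primrec.nat_sub.comp .list_length (.const 1)))))
  refine ⟨_, Primrec₂.to_comp hR.decide, fun a => ?_⟩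
  rw [hp, not_exists]
  simp only [decide_eq_true_eq, List.length_map, List.length_range]
  have get : ∀ (f : ℕ → ℕ) {i k : ℕ}, i < k → ((List.range k).map f).getD i 0 = f i := by
    intro f i k hi
    rw [List.getD_eq_getElem _ _ (by simpa using hi)]
    simp
  refine ⟨fun h f => ?_, fun h c ⟨h₀, hc⟩ => ?_⟩
  · by_contra! hf
    refine h (fun i => dec (f i)) ⟨?_, fun i => ?_⟩
    · have := (hf 2 le_rfl).1
      rwa [get f (by omega)] at this
    · have := (hf (i + 2) (by omega)).2
      rwa [get f (by omega), get f (by omega)] at this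
  · obtain ⟨k, hk, hn⟩ := h fun i => Encodable.encode (c i)
    obtain ⟨i, rfl⟩ := Nat.exists_eq_add_of_le' hk
    refine hn ⟨?_, ?_⟩
    · rw [get _ (by omega)]
      simpa [dec] using h₀
    · rw [get _ (by omega), get _ (by omega)]
      simpa [dec] using hc i

theorem exists_recurring_iff_countdown {σ : Type} {Init P : σ → Prop} {Step : σ → σ → Prop} :
    (∃ c : ℕ → σ, Init (c 0) ∧ (∀ i, Step (c i) (c (i + 1))) ∧ ∀ N, ∃ i, N ≤ i ∧ P (c i)) ↔
    ∃ c : ℕ → σ × ℕ, Init (c 0).1 ∧ ∀ i, Step (c i).1 (c (i + 1)).1 ∧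
      (P (c i).1 ∨ (c (i + 1)).2 < (c i).2) := by
  classical
  constructor
  · rintro ⟨c, h₀, hc, hP⟩
    have hP : ∀ N, ∃ d, P (c (N + d)) := fun N => by
      obtain ⟨i, hi, h⟩ := hP N
      exact ⟨i - N, by rwa [Nat.add_sub_cancel' hi]⟩
    refine ⟨fun i => (c i, Nat.find (hP i)), h₀, fun i => ⟨hc i, ?_⟩⟩
    have := Nat.find_spec (hP i)
    rcases h : Nat.find (hP i) with _ | d
    · rw [h] at this
      exact .inl this
    · rw [h, ← Nat.add_assoc, Nat.add_right_comm] at this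
      exact .inr ((Nat.find_min' (hP (i + 1)) this).trans_lt (by simp only [h, Nat.lt_succ_self]))
  · rintro ⟨c, h₀, hc⟩
    refine ⟨fun i => (c i).1, h₀, fun i => (hc i).1, fun N => ?_⟩
    induction h : (c N).2 using Nat.strong_induction_on generalizing N with
    | _ n ih =>
      rcases (hc N).2 with hP | hlt
      · exact ⟨N, le_rfl, hP⟩
      · obtain ⟨i, hi, hP⟩ := ih _ (h ▸ hlt) (N + 1) rfl
        exact ⟨i, by omega, hP⟩

theorem primrec_numStates : Primrec NTM.numStates := .fst

theorem primrec_blank : Primrec NTM.blank := Primrec.fst.comp .snd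

theorem primrec_table : Primrec NTM.table := Primrec.snd.comp .snd

theorem primrecPred_wf : PrimrecPred NTM.WF := by
  refine .and (Primrec.nat_le.comp (.const 1) primrec_numStates)
    (.and (Primrec.nat_le.comp (.const 2) primrec_blank) ?_)
  have h : PrimrecRel fun (e : (ℕ × ℕ) × (ℕ × ℕ × Bool)) (M : NTM) =>
      e.1.1 < NTM.numStates M ∧ e.1.2 ≤ NTM.blank M ∧
        e.2.1 < NTM.numStates M ∧ e.2.2.1 < NTM.blank M := by
    have hn : Primrec fun t : ((ℕ × ℕ) × (ℕ × ℕ × Bool)) × NTM => t.2.numStates :=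
      primrec_numStates.comp .snd
    have hb : Primrec fun t : ((ℕ × ℕ) × (ℕ × ℕ × Bool)) × NTM => t.2.blank :=
      primrec_blank.comp .snd
    refine .and (Primrec.nat_lt.comp ?_ hn) (.and (Primrec.nat_le.comp ?_ hb)
      (.and (Primrec.nat_lt.comp ?_ hn) (Primrec.nat_lt.comp ?_ hb)))
    · exact Primrec.fst.comp (Primrec.fst.comp .fst)
    · exact Primrec.snd.comp (Primrec.fst.comp .fst)
    · exact Primrec.fst.comp (Primrec.snd.comp .fst)
    · exact Primrec.fst.comp (Primrec.snd.comp (Primrec.snd.comp .fst))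
  exact h.forall_mem_list.comp primrec_table .id

theorem primrecRel_wfConfig : PrimrecRel WFConfig := by
  have ht : Primrec fun t : NTM × Config => t.2.1 := Primrec.fst.comp .snd
  have hb : Primrec fun t : NTM × Config => t.1.blank := primrec_blank.comp .fst
  have hlen : Primrec fun t : NTM × Config => t.2.1.length := Primrec.list_length.comp ht
  refine .and (Primrec.nat_lt.comp (Primrec.fst.comp (Primrec.snd.comp .snd)) hlen) (.and ?_
    (.and ?_ (.and ?_ (Primrec.nat_lt.comp (Primrec.snd.comp (Primrec.snd.comp .snd))
      (primrec_numStates.comp .fst)))))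
  · refine (Primrec.eq.comp ((Primrec.list_getElem?.comp ht
      (Primrec.nat_sub.comp hlen (.const 1)))) (Primrec.option_some.comp hb)).of_eq fun t => ?_
    rw [List.getLast?_eq_getElem?]
  · have h : PrimrecRel fun (i : ℕ) (u : ℕ × NTM × Config) =>
        u.2.2.1.getD i 0 = u.2.1.blank → u.2.2.1.getD u.1 0 = u.2.1.blank := by
      have hb : Primrec fun u : ℕ × ℕ × NTM × Config => u.2.2.1.blank :=
        primrec_blank.comp (Primrec.fst.comp (Primrec.snd.comp .snd))
      have ht : Primrec fun u : ℕ × ℕ × NTM × Config => u.2.2.2.1 :=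
        Primrec.fst.comp (Primrec.snd.comp (Primrec.snd.comp .snd))
      refine ((PrimrecPred.not (Primrec.eq.comp ((Primrec.list_getD 0).comp ht .fst) hb)).or
        (Primrec.eq.comp ((Primrec.list_getD 0).comp ht (Primrec.fst.comp .snd)) hb)).of_eq
          fun u => imp_iff_not_or.symm
    have h : PrimrecRel fun (j : ℕ) (t : NTM × Config) => ∀ i ∈ List.range (j + 1),
        t.2.1.getD i 0 = t.1.blank → t.2.1.getD j 0 = t.1.blank :=
      PrimrecRel.comp h.forall_mem_list
        (Primrec.list_range.comp (Primrec.succ.comp Primrec.fst)) Primrec.id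
    refine (h.forall_mem_list.comp (Primrec.list_range.comp hlen) .id).of_eq fun t => ?_
    simp only [List.mem_range, id]
    exact ⟨fun h i j hij hj => h j hj i (Nat.lt_succ_of_le hij),
      fun h j hj i hij => h i j (Nat.le_of_lt_succ hij) hj⟩
  · have h : PrimrecRel fun (a : ℕ) (t : NTM × Config) => a ≤ t.1.blank :=
      Primrec.nat_le.comp .fst (hb.comp .snd)
    exact h.forall_mem_list.comp ht .id

theorem primrec_set_comp {α : Type*} [Primcodable α] {f : α → List ℕ} {g h : α → ℕ}
    (hf : Primrec f) (hg : Primrec g) (hh : Primrec h) :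
    Primrec fun a => (f a).set (g a) (h a) :=
  have := Primrec.list_set (α := ℕ)
  Primrec₂.comp this hf (.pair hg hh)

theorem primrecPred_next : PrimrecPred fun t : NTM × Config × Config => t.1.Next t.2.1 t.2.2 := by
  let T := ((ℕ × ℕ) × (ℕ × ℕ × Bool)) × NTM × Config × Config
  have h : PrimrecRel fun (e : (ℕ × ℕ) × (ℕ × ℕ × Bool)) (t : NTM × Config × Config) =>
      e.1 = (t.2.1.2.2, t.2.1.1.getD t.2.1.2.1 0) ∧ (e.2.2.2 = true ∨ 1 ≤ t.2.1.2.1) ∧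
        t.2.2 = (t.2.1.1.set t.2.1.2.1 e.2.2.1 ++ [t.1.blank],
          bif e.2.2.2 then t.2.1.2.1 + 1 else t.2.1.2.1 - 1, e.2.1) := by
    have hc : Primrec fun u : T => u.2.2.1 := Primrec.fst.comp (Primrec.snd.comp .snd)
    have ht : Primrec fun u : T => u.2.2.1.1 := Primrec.fst.comp hc
    have hp : Primrec fun u : T => u.2.2.1.2.1 := Primrec.fst.comp (Primrec.snd.comp hc)
    have hq : Primrec fun u : T => u.2.2.1.2.2 := Primrec.snd.comp (Primrec.snd.comp hc)
    have he : Primrec fun u : T => u.1.2 := Primrec.snd.comp .fst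
    have hq' : Primrec fun u : T => u.1.2.1 := Primrec.fst.comp he
    have hw : Primrec fun u : T => u.1.2.2.1 := Primrec.fst.comp (Primrec.snd.comp he)
    have hd : Primrec fun u : T => u.1.2.2.2 := Primrec.snd.comp (Primrec.snd.comp he)
    have hset : Primrec fun u : T => u.2.2.1.1.set u.2.2.1.2.1 u.1.2.2.1 :=
      primrec_set_comp ht hp hw
    have hb : Primrec fun u : T => u.2.1.blank := primrec_blank.comp (Primrec.fst.comp .snd)
    have hmove : Primrec fun u : T =>
        bif u.1.2.2.2 then u.2.2.1.2.1 + 1 else u.2.2.1.2.1 - 1 :=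
      Primrec.cond hd (Primrec.succ.comp hp) (Primrec.nat_sub.comp hp (.const 1))
    have hget : Primrec fun u : T => u.2.2.1.1.getD u.2.2.1.2.1 0 :=
      (Primrec.list_getD 0).comp ht hp
    have hconcat : Primrec fun u : T => u.2.2.1.1.set u.2.2.1.2.1 u.1.2.2.1 ++ [u.2.1.blank] :=
      Primrec.list_concat.comp hset hb
    have h₁ : PrimrecPred fun u : T => u.1.1 = (u.2.2.1.2.2, u.2.2.1.1.getD u.2.2.1.2.1 0) :=
      Primrec.eq.comp (Primrec.fst.comp .fst) (.pair hq hget)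
    have h₂ : PrimrecPred fun u : T => u.1.2.2.2 = true ∨ 1 ≤ u.2.2.1.2.1 :=
      (Primrec.eq.comp hd (.const true)).or (Primrec.nat_le.comp (.const 1) hp)
    have h₃ : PrimrecPred fun u : T => u.2.2.2 =
        (u.2.2.1.1.set u.2.2.1.2.1 u.1.2.2.1 ++ [u.2.1.blank],
          bif u.1.2.2.2 then u.2.2.1.2.1 + 1 else u.2.2.1.2.1 - 1, u.1.2.1) :=
      Primrec.eq.comp (Primrec.snd.comp (Primrec.snd.comp .snd))
        (.pair hconcat (.pair hmove hq'))
    exact h₁.and (h₂.and h₃)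
  refine (h.exists_mem_list.comp (primrec_table.comp .fst) .id).of_eq fun t => ?_
  constructor
  · rintro ⟨⟨qa, q', b, d⟩, he, rfl, h₁, h₂⟩
    exact ⟨q', b, d, he, h₁, h₂.trans (by simp only [id, Bool.cond_eq_ite])⟩
  · rintro ⟨q', b, d, he, h₁, h₂⟩
    exact ⟨_, he, rfl, h₁, h₂.trans (by simp only [id, Bool.cond_eq_ite])⟩

theorem robustNonRecurring_pi11 :
    Pi11 (fun p : NTM × ℕ => NTM.WF p.1 ∧ p.2 < NTM.numStates p.1 ∧
      ∀ ρ, WFConfig p.1 ρ → NonRecurringFrom p.1 p.2 ρ) := by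
  have hA : PrimrecPred fun p : NTM × ℕ => p.1.WF ∧ p.2 < p.1.numStates :=
    .and (primrecPred_wf.comp .fst) (Primrec.nat_lt.comp .snd (primrec_numStates.comp .fst))
  refine pi11_of_chain (σ := Config × ℕ)
    (Init := fun p x => ¬ (p.1.WF ∧ p.2 < p.1.numStates) ∨ WFConfig p.1 x.1)
    (Step := fun p x y => ¬ (p.1.WF ∧ p.2 < p.1.numStates) ∨ p.1.Next x.1 y.1 ∧
      (x.1.2.2 = p.2 ∨ y.2 < x.2)) ?_ ?_ fun p => ?_
  · exact .or (.not (hA.comp .fst))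
      (primrecRel_wfConfig.comp (Primrec.fst.comp .fst) (Primrec.fst.comp .snd))
  · have hx : Primrec fun t : (NTM × ℕ) × (Config × ℕ) × (Config × ℕ) => t.2.1 :=
      Primrec.fst.comp .snd
    have hy : Primrec fun t : (NTM × ℕ) × (Config × ℕ) × (Config × ℕ) => t.2.2 :=
      Primrec.snd.comp .snd
    refine .or (.not (hA.comp .fst)) (.and ?_ (.or ?_ ?_))
    · exact primrecPred_next.comp
        (.pair (Primrec.fst.comp .fst) (.pair (Primrec.fst.comp hx) (Primrec.fst.comp hy)))
    · exact Primrec.eq.comp (Primrec.snd.comp (Primrec.snd.comp (Primrec.fst.comp hx)))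
        (Primrec.snd.comp .fst)
    · exact Primrec.nat_lt.comp (Primrec.snd.comp hy) (Primrec.snd.comp hx)
  · rw [← and_assoc]
    by_cases h : p.1.WF ∧ p.2 < p.1.numStates
    · simp only [h, not_true, false_or, true_and]
      rw [← exists_recurring_iff_countdown (Init := WFConfig p.1) (P := fun ρ => ρ.2.2 = p.2)]
      simp only [NonRecurringFrom, RecurringFrom]
      constructor
      · rintro h ⟨c, h₀, hc⟩
        exact h _ h₀ ⟨c, rfl, hc⟩
      · rintro h ρ hρ ⟨c, rfl, hc⟩
        exact h ⟨c, hρ, hc⟩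
    · simp [h]

/-- Deciding, given a non-deterministic Turing machine `M` and a state `q_r`
of `M`, whether `M` is robust non-recurring through `q_r` (every run of `M` starting from any
configuration features `q_r` only finitely many times) is `Π¹₁`-complete. -/
theorem robustNonRecurring_Pi11Complete :
    Pi11Complete (fun p : NTM × ℕ =>
      NTM.WF p.1 ∧ p.2 < NTM.numStates p.1 ∧
      ∀ ρ : Config, WFConfig p.1 ρ → NonRecurringFrom p.1 p.2 ρ) := by
  exact ⟨robustNonRecurring_pi11, robustNonRecurring_pi11Hard⟩

end ChaseTermination
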